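/- arXiv:2106.09404 — 3 statements merged into one kernel-verified Lean document; each statement's English description precedes it below -/
import Mathlib

section
/- Let (R, m) be a one-dimensional Cohen-Macaulay local ring satisfying conditions (a)-(c) (fractional canonical ideal C with R ⊆ C ⊆ R̄, R̄ module-finite over R, R̄ local). Then the following are equivalent: (i) (R : C)·C = R : R̄; (ii) (R : C)·C is isomorphic to R̄ as an R-module; (iii) C² = R̄. -/
set_option synthInstance.maxHeartbeats 400000

open IsLocalRing

/-- `C ⊆ Q(R)` is a fractional canonical ideal of `R`: it is a finitely generated
`R`-submodule of the total quotient ring which is dualizing for fractional ideals,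
i.e. `C : (C : I) = I` for every fractional ideal `I`. -/
def IsCanonicalIdeal (R : Type*) [CommRing R] (C : Submodule R (FractionRing R)) : Prop :=
  C.FG ∧ ∀ I : Submodule R (FractionRing R), I.FG →
    (∃ r ∈ nonZeroDivisors R, algebraMap R (FractionRing R) r ∈ I) → C / (C / I) = I

section TotalQuotientRing

variable {R : Type*} [CommRing R]

/-- The total quotient ring of a one-dimensional Cohen–Macaulay local ring is zero-dimensional. -/
theorem krullDimLE_zero_of_isFractionRing [IsLocalRing R] [Ring.KrullDimLE 1 R]
    (hCM : ∃ x ∈ maximalIdeal R, x ∈ nonZeroDivisors R)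
    (K : Type*) [CommRing K] [Algebra R K] [IsFractionRing R K] : Ring.KrullDimLE 0 K := by
  obtain ⟨x, hxm, hx⟩ := hCM
  have comap_minimal (P : Ideal K) (hP : P.IsPrime) :
      P.comap (algebraMap R K) ∈ minimalPrimes R := by
    refine (Ring.krullDimLE_one_iff.mp ‹_› _ (hP.comap _)).resolve_right fun hmax ↦ ?_
    rw [← IsLocalRing.eq_maximalIdeal hmax, Ideal.mem_comap] at hxm
    exact hP.ne_top (Ideal.eq_top_of_isUnit_mem _ hxm (IsLocalization.map_units K ⟨x, hx⟩))
  refine Ring.KrullDimLE.mk₀ fun P hP ↦ ?_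
  obtain ⟨Q, hQ, hPQ⟩ := P.exists_le_maximal hP.ne_top
  have hle := (comap_minimal Q hQ.isPrime).2 (comap_minimal P hP).1
    (Ideal.comap_mono (f := algebraMap R K) hPQ)
  suffices P = Q from this ▸ hQ
  refine hPQ.antisymm ?_
  rw [← IsLocalization.map_under (nonZeroDivisors R) K Q,
    ← IsLocalization.map_under (nonZeroDivisors R) K P]
  exact Ideal.map_mono hle

/-- If the integral closure of `R` in its total quotient ring `K` is module-finite, then `K` is
reduced. -/
theorem isReduced_of_fg_integralClosure [IsNoetherianRing R] [IsLocalRing R]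
    (hCM : ∃ x ∈ maximalIdeal R, x ∈ nonZeroDivisors R)
    (K : Type*) [CommRing K] [Algebra R K] [IsFractionRing R K]
    (hfin : (Subalgebra.toSubmodule (integralClosure R K)).FG) : IsReduced K := by
  obtain ⟨x, hxm, hx⟩ := hCM
  let N : Submodule R K := (nilradical K).restrictScalars R
  have hN : N ≤ Subalgebra.toSubmodule (integralClosure R K) := by
    rintro a ⟨n, hn⟩
    exact IsIntegral.of_pow (n := n + 1) n.succ_pos (by
      rw [pow_succ, show a ^ n = 0 from hn, zero_mul]; exact isIntegral_zero)
  have hbot : N = ⊥ := by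
    refine Submodule.eq_bot_of_le_smul_of_le_jacobson_bot (maximalIdeal R) N (hfin.of_le hN) ?_
      (IsLocalRing.maximalIdeal_le_jacobson _)
    intro a ha
    obtain ⟨u, hu⟩ := IsLocalization.map_units K ⟨x, hx⟩
    have : a = x • ((↑u⁻¹ : K) * a) := by
      rw [Algebra.smul_def, ← mul_assoc]
      simp only at hu
      rw [← hu, Units.mul_inv, one_mul]
    rw [this]
    exact Submodule.smul_mem_smul hxm ((nilradical K).mul_mem_left _ ha)
  refine ⟨fun a ha ↦ ?_⟩
  have : a ∈ N := ha
  simpa [hbot] using this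

/-- A reduced Artinian ring all of whose idempotents are trivial is a field. -/
theorem isField_of_isIdempotentElem_trivial (K : Type*) [CommRing K] [Nontrivial K]
    [IsArtinianRing K] [IsReduced K] (h : ∀ e : K, IsIdempotentElem e → e = 0 ∨ e = 1) :
    IsField K := by
  refine ⟨exists_pair_ne K, mul_comm, fun {a} ha ↦ ?_⟩
  obtain ⟨n, z, hz⟩ := IsArtinian.exists_pow_succ_smul_dvd a (1 : K)
  simp only [smul_eq_mul, mul_one, pow_succ] at hz
  have key (k : ℕ) : a ^ n * (a * z) ^ k = a ^ n := by
    induction k with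
    | zero => simp
    | succ k ih => rw [pow_succ, ← mul_assoc, ih, ← mul_assoc, hz]
  have hidem : IsIdempotentElem ((a * z) ^ n) := by
    rw [IsIdempotentElem]
    nth_rw 1 [mul_pow]
    rw [mul_right_comm, key, ← mul_pow]
  rcases h _ hidem with h0 | h1
  · exact absurd (eq_zero_of_pow_eq_zero (n := n) (by simpa [h0] using (key n).symm)) ha
  · rcases n.eq_zero_or_pos with rfl | hn
    · exact ⟨z, by simpa using hz⟩
    · obtain ⟨b, hb⟩ := (IsUnit.of_pow_eq_one h1 hn.ne').exists_right_inv
      exact ⟨z * b, by rw [← mul_assoc, hb]⟩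

/-- If the integral closure of `R` in `K` is local, then `K` has only trivial idempotents. -/
theorem eq_zero_or_one_of_isIdempotentElem_of_isLocalRing_integralClosure
    {K : Type*} [CommRing K] [Algebra R K] [IsLocalRing (integralClosure R K)]
    {e : K} (he : IsIdempotentElem e) : e = 0 ∨ e = 1 := by
  have hint : IsIntegral R e :=
    ⟨Polynomial.X ^ 2 - Polynomial.X, by monicity!, by simp [pow_two, he.eq]⟩
  have hmul : e * (1 - e) = 0 := by rw [mul_sub, he.eq, mul_one, sub_self]
  let e' : integralClosure R K := ⟨e, hint⟩
  have hmul' : e' * (1 - e') = 0 := Subtype.ext hmul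
  rcases IsLocalRing.isUnit_or_isUnit_one_sub_self e' with hu | hu
  · right
    exact (sub_eq_zero.mp (congrArg Subtype.val (hu.mul_right_eq_zero.mp hmul'))).symm
  · left
    exact congrArg Subtype.val (hu.mul_left_eq_zero.mp hmul')

/-- The total quotient ring of a one-dimensional Cohen–Macaulay local ring whose integral closure
is module-finite and local is a field. -/
theorem isField_of_isLocalRing_integralClosure [IsNoetherianRing R] [IsLocalRing R]
    [Ring.KrullDimLE 1 R] (hCM : ∃ x ∈ maximalIdeal R, x ∈ nonZeroDivisors R)
    (K : Type*) [CommRing K] [Algebra R K] [IsFractionRing R K]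
    (hfin : (Subalgebra.toSubmodule (integralClosure R K)).FG)
    [IsLocalRing (integralClosure R K)] : IsField K := by
  have := krullDimLE_zero_of_isFractionRing hCM K
  have := IsLocalization.isNoetherianRing (nonZeroDivisors R) K ‹_›
  have : IsArtinianRing K := isArtinianRing_iff_isNoetherianRing_krullDimLE_zero.mpr ⟨‹_›, ‹_›⟩
  have := isReduced_of_fg_integralClosure hCM K hfin
  have : Nontrivial K := (IsFractionRing.injective R K).nontrivial
  exact isField_of_isIdempotentElem_trivial K fun e he ↦
    eq_zero_or_one_of_isIdempotentElem_of_isLocalRing_integralClosure (R := R) he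

/-- The integral closure of a one-dimensional Noetherian domain in its fraction field is a principal
ideal ring as soon as it is module-finite and local. -/
theorem isPrincipalIdealRing_integralClosure_of_isLocalRing [IsNoetherianRing R] [IsDomain R]
    [Ring.KrullDimLE 1 R] (K : Type*) [Field K] [Algebra R K] [IsFractionRing R K]
    (hfin : (Subalgebra.toSubmodule (integralClosure R K)).FG)
    [IsLocalRing (integralClosure R K)] : IsPrincipalIdealRing (integralClosure R K) := by
  have : Module.Finite R (integralClosure R K) := Module.Finite.iff_fg.mpr hfin
  have : IsNoetherianRing (integralClosure R K) := isNoetherian_of_tower R inferInstance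
  have : Ring.DimensionLEOne R := ⟨fun hI hp ↦ hp.isMaximal_of_ne_bot hI⟩
  have : Ring.DimensionLEOne (integralClosure R K) := inferInstance
  have : IsIntegrallyClosed (integralClosure R K) :=
    integralClosure.isIntegrallyClosedOfFiniteExtension K
  have : IsDedekindDomain (integralClosure R K) := { }
  exact ((tfae_of_isNoetherianRing_of_isLocalRing_of_isDomain _).out 0 2 rfl rfl).mpr this

end TotalQuotientRing

section Colon

variable {R K : Type*} [CommRing R] [CommRing K] [Algebra R K]

theorem Submodule.div_div_eq_div_mul_of_comm (A B D : Submodule R K) : A / B / D = A / (B * D) := by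
  apply le_antisymm
  · rw [Submodule.le_div_iff_mul_le, mul_comm B D, ← mul_assoc]
    exact (mul_le_mul_left (Submodule.le_div_iff_mul_le.mp le_rfl) B).trans
      (Submodule.le_div_iff_mul_le.mp le_rfl)
  · rw [Submodule.le_div_iff_mul_le, Submodule.le_div_iff_mul_le, mul_assoc, mul_comm D B]
    exact Submodule.le_div_iff_mul_le.mp le_rfl

theorem Submodule.div_one_eq_self (A : Submodule R K) : A / 1 = A := by
  apply le_antisymm
  · have := Submodule.le_div_iff_mul_le.mp (le_refl (A / 1))
    rwa [mul_one] at this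
  · rw [Submodule.le_div_iff_mul_le, mul_one]

theorem Submodule.div_anti_right (A : Submodule R K) {B D : Submodule R K} (h : B ≤ D) :
    A / D ≤ A / B :=
  fun _ hx y hy ↦ hx y (h hy)

/-- A submodule sandwiched between `1` and a subalgebra `S` acts trivially on `S`. -/
theorem Subalgebra.mul_toSubmodule_of_le (S : Subalgebra R K) {C : Submodule R K} (h1 : 1 ≤ C)
    (hC : C ≤ Subalgebra.toSubmodule S) :
    C * Subalgebra.toSubmodule S = Subalgebra.toSubmodule S := by
  apply le_antisymm
  · exact (mul_le_mul_left hC _).trans S.isIdempotentElem_toSubmodule.eq.le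
  · simpa using mul_le_mul_left h1 (Subalgebra.toSubmodule S)

theorem Subalgebra.div_mul_toSubmodule (S : Subalgebra R K) (A : Submodule R K) :
    A / Subalgebra.toSubmodule S * Subalgebra.toSubmodule S = A / Subalgebra.toSubmodule S := by
  apply le_antisymm
  · rw [Submodule.le_div_iff_mul_le, mul_assoc, S.isIdempotentElem_toSubmodule.eq]
    exact Submodule.le_div_iff_mul_le.mp le_rfl
  · simpa using mul_le_mul_right (Submodule.one_le.mpr S.one_mem) (A / Subalgebra.toSubmodule S)

/-- A submodule of the total quotient ring which is isomorphic to a subalgebra `S` is stable under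
multiplication by `S`. -/
theorem Subalgebra.mul_mem_of_linearEquiv [IsFractionRing R K] (S : Subalgebra R K)
    {T : Submodule R K} (φ : T ≃ₗ[R] Subalgebra.toSubmodule S) {t s : K} (ht : t ∈ T)
    (hs : s ∈ S) : t * s ∈ T := by
  have key (x : Subalgebra.toSubmodule S) :
      (φ.symm x : K) = x * φ.symm ⟨1, S.one_mem⟩ := by
    obtain ⟨⟨a, b⟩, hab⟩ := IsLocalization.surj (nonZeroDivisors R) (x : K)
    have hsmul : (b : R) • x = a • (⟨1, S.one_mem⟩ : Subalgebra.toSubmodule S) :=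
      Subtype.ext (by simpa [Algebra.smul_def, mul_comm] using hab)
    have h := congrArg (fun y ↦ (φ.symm y : K)) hsmul
    simp only [map_smul, Submodule.coe_smul, Algebra.smul_def] at h
    apply (IsLocalization.map_units K b).mul_left_cancel
    rw [h, ← hab]
    ring
  obtain ⟨x, rfl⟩ : ∃ x, (φ.symm x : K) = t := ⟨φ ⟨t, ht⟩, by simp⟩
  have : (φ.symm x : K) * s = φ.symm ⟨x * s, S.mul_mem x.2 hs⟩ := by
    rw [key x, key ⟨x * s, _⟩]
    ring
  rw [this]
  exact Subtype.property _

/-- A nonzero fractional ideal contained in a principal ideal domain `S` and stable under `S` is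
isomorphic to `S`. -/
theorem Subalgebra.nonempty_linearEquiv_of_isPrincipalIdealRing [IsDomain K] (S : Subalgebra R K)
    [IsPrincipalIdealRing S] {J : Submodule R K} (hJ : J ≠ ⊥)
    (hJS : J ≤ Subalgebra.toSubmodule S) (hstable : ∀ t ∈ J, ∀ s ∈ S, t * s ∈ J) :
    Nonempty (J ≃ₗ[R] Subalgebra.toSubmodule S) := by
  let I : Ideal S :=
    { carrier := {x | (x : K) ∈ J}
      add_mem' := fun ha hb ↦ J.add_mem ha hb
      zero_mem' := J.zero_mem
      smul_mem' := fun c x hx ↦ by simpa [mul_comm] using hstable x hx c c.2 }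
  obtain ⟨α, hα⟩ := IsPrincipalIdealRing.principal I
  have mem_iff (x : S) : (x : K) ∈ J ↔ ∃ c : S, c * α = x := by
    change x ∈ I ↔ _
    rw [hα, Submodule.mem_span_singleton]
    rfl
  have hαJ : (α : K) ∈ J := (mem_iff α).mpr ⟨1, one_mul α⟩
  have hα0 : (α : K) ≠ 0 := by
    rintro h0
    refine hJ (eq_bot_iff.mpr fun x hx ↦ ?_)
    obtain ⟨c, hc⟩ := (mem_iff ⟨x, hJS hx⟩).mp hx
    have := congrArg Subtype.val hc
    simpa [h0] using this.symm
  let f : Subalgebra.toSubmodule S →ₗ[R] J :=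
    ((LinearMap.mulLeft R (α : K)).comp (Subalgebra.toSubmodule S).subtype).codRestrict J
      fun s ↦ hstable α hαJ s s.2
  refine ⟨(LinearEquiv.ofBijective f ⟨fun x y hxy ↦ ?_, fun y ↦ ?_⟩).symm⟩
  · exact Subtype.ext (mul_left_cancel₀ hα0 (congrArg Subtype.val hxy))
  · obtain ⟨c, hc⟩ := (mem_iff ⟨y, hJS y.2⟩).mp y.2
    exact ⟨c, Subtype.ext ((mul_comm _ _).trans (congrArg Subtype.val hc))⟩

/-- The conductor of a module-finite subalgebra of the total quotient ring is nonzero. -/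
theorem Submodule.one_div_ne_bot_of_fg [Nontrivial K] [IsFractionRing R K] {M : Submodule R K}
    (hM : M.FG) : (1 : Submodule R K) / M ≠ ⊥ := by
  obtain ⟨a, ha, h⟩ := FractionalIdeal.isFractional_of_fg (S := nonZeroDivisors R) hM
  intro hbot
  have : algebraMap R K a ∈ (1 : Submodule R K) / M := fun y hy ↦ by
    rw [← Algebra.smul_def]
    exact Submodule.mem_one.mpr (h y hy)
  rw [hbot, Submodule.mem_bot] at this
  exact (IsLocalization.map_units K (⟨a, ha⟩ : nonZeroDivisors R)).ne_zero this

end Colon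

/-- Let `(R, 𝔪)` be a one-dimensional Cohen–Macaulay local ring with a
fractional canonical ideal `C`, `R ⊆ C ⊆ R̄`, where the integral closure `R̄` is
module-finite over `R` and local. Then the following are equivalent:
(i) `(R : C)·C = R : R̄` (i.e. `R` is far-flung Gorenstein);
(ii) `(R : C)·C ≅ R̄` as `R`-modules;
(iii) `C² = R̄`. -/
theorem farFlungGorenstein_tfae (R : Type*) [CommRing R] [IsNoetherianRing R] [IsLocalRing R]
    (hdim : ringKrullDim R = 1)
    (hCM : ∃ x ∈ maximalIdeal R, x ∈ nonZeroDivisors R)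
    (C : Submodule R (FractionRing R))
    (hcan : IsCanonicalIdeal R C)
    (hRC : (1 : Submodule R (FractionRing R)) ≤ C)
    (hCRbar : C ≤ Subalgebra.toSubmodule (integralClosure R (FractionRing R)))
    (hfin : (Subalgebra.toSubmodule (integralClosure R (FractionRing R))).FG)
    (hloc : IsLocalRing (integralClosure R (FractionRing R))) :
    (((1 : Submodule R (FractionRing R)) / C) * C =
        (1 : Submodule R (FractionRing R)) /
          Subalgebra.toSubmodule (integralClosure R (FractionRing R)) ↔
      Nonempty ((((1 : Submodule R (FractionRing R)) / C) * C : Submodule R (FractionRing R))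
        ≃ₗ[R] (Subalgebra.toSubmodule (integralClosure R (FractionRing R)) : Submodule R (FractionRing R)))) ∧
    (((1 : Submodule R (FractionRing R)) / C) * C =
        (1 : Submodule R (FractionRing R)) /
          Subalgebra.toSubmodule (integralClosure R (FractionRing R)) ↔
      C * C = Subalgebra.toSubmodule (integralClosure R (FractionRing R))) := by
  set K := FractionRing R
  set A := integralClosure R K
  set S : Submodule R K := Subalgebra.toSubmodule A
  have : Ring.KrullDimLE 1 R := Ring.krullDimLE_iff.mpr hdim.le
  have one_regular : ∃ r ∈ nonZeroDivisors R, algebraMap R K r ∈ (1 : Submodule R K) :=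
    ⟨1, one_mem _, Submodule.algebraMap_mem 1⟩
  have one_eq : C / C = 1 := by
    have := hcan.2 1 (by rw [Submodule.one_eq_span]; exact Submodule.fg_span_singleton 1)
      one_regular
    rwa [Submodule.div_one_eq_self] at this
  have one_div (I : Submodule R K) : 1 / I = C / (C * I) := by
    rw [← one_eq, Submodule.div_div_eq_div_mul_of_comm]
  have hCS : C * S = S := Subalgebra.mul_toSubmodule_of_le A hRC hCRbar
  have trace_le : 1 / C * C ≤ 1 := Submodule.le_div_iff_mul_le.mp le_rfl
  have le_trace : 1 / C ≤ 1 / C * C := by simpa using mul_le_mul_right hRC (1 / C)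
  have conductor_le : 1 / S ≤ 1 / C := Submodule.div_anti_right 1 hCRbar
  have conductor_mul : 1 / S * S = 1 / S := Subalgebra.div_mul_toSubmodule A 1
  have conductor_le_one : 1 / S ≤ 1 :=
    (conductor_le.trans le_trace).trans trace_le
  refine ⟨⟨fun h ↦ ?_, fun ⟨φ⟩ ↦ ?_⟩, fun h ↦ ?_, fun h ↦ ?_⟩
  · have hK : IsField K := isField_of_isLocalRing_integralClosure hCM K hfin
    have : IsDomain K := hK.isDomain
    have : IsDomain R := (IsFractionRing.injective R K).isDomain
    have : IsPrincipalIdealRing A := by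
      let := hK.toField
      exact isPrincipalIdealRing_integralClosure_of_isLocalRing K hfin
    rw [h]
    refine Subalgebra.nonempty_linearEquiv_of_isPrincipalIdealRing A
      (Submodule.one_div_ne_bot_of_fg hfin) (conductor_le_one.trans (hRC.trans hCRbar)) ?_
    exact fun t ht s hs ↦ conductor_mul.le (Submodule.mul_mem_mul ht hs)
  · exact le_antisymm
      (fun t ht s hs ↦ trace_le (Subalgebra.mul_mem_of_linearEquiv A φ ht hs))
      (conductor_le.trans le_trace)
  · have hdiv : C / (C * C) = C / S := by
      rw [← one_div, ← hCS, ← one_div]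
      exact le_antisymm (le_trace.trans h.le) conductor_le
    have one_le_mul : (1 : Submodule R K) ≤ C * C := by simpa using mul_le_mul' hRC hRC
    rw [← hcan.2 (C * C) (hcan.1.mul hcan.1) (one_regular.imp fun r hr ↦ ⟨hr.1, one_le_mul hr.2⟩),
      hdiv, hcan.2 S hfin (one_regular.imp fun r hr ↦ ⟨hr.1, (hRC.trans hCRbar) hr.2⟩)]
  · have hdiv : 1 / C = 1 / S := by rw [one_div, one_div, h, hCS]
    rw [hdiv]
    exact le_antisymm ((mul_le_mul_right hCRbar _).trans conductor_mul.le) (hdiv ▸ le_trace)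
end

section
/- Let (R, m) be a Cohen-Macaulay local ring with multiplicity e(R) > 1. Then r(R) + 1 ≤ e(R), where r(R) is the Cohen-Macaulay type. Moreover, equality r(R) + 1 = e(R) holds if and only if R has minimal multiplicity (i.e., m² = Qm for some parameter ideal Q that is a reduction of m, after possibly extending the residue field). -/
open IsLocalRing CategoryTheory

universe u

namespace CategoryTheory.ProjectiveResolution

open Abelian CochainComplex HomComplex

variable {R : Type u} [CommRing R] {X Y : ModuleCat.{u} R} (P : ProjectiveResolution X)

lemma extMk_zero_eq_zero_iff (f : P.complex.X 0 ⟶ Y) (hf : P.complex.d 1 0 ≫ f = 0) :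
    P.extMk f 1 rfl hf = 0 ↔ f = 0 := by
  refine ⟨fun h => ?_, fun h => by subst h; simp⟩
  rw [← P.extEquivCohomologyClass.apply_eq_iff_eq,
    extEquivCohomologyClass_extMk, extEquivCohomologyClass_zero,
    CohomologyClass.mk_eq_zero_iff,
    Cocycle.toSingleMk_mem_coboundaries_iff _ _ _ _ _ 1 (by lia)] at h
  obtain ⟨g, hg⟩ := h
  have hz : Limits.IsZero (P.cochainComplex.X 1) := by
    exact P.cochainComplex.isZero_of_isStrictlyLE 0 1
  rw [hz.eq_zero_of_src g, Limits.comp_zero] at hg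
  rw [← cancel_epi (P.cochainComplexXIso (-(0:ℕ)) 0 rfl).hom, ← hg, Limits.comp_zero]

lemma smul_extMk {n : ℕ} (r : R) (f : P.complex.X n ⟶ Y) (m : ℕ) (hm : n + 1 = m)
    (hf : P.complex.d m n ≫ f = 0) :
    r • P.extMk f m hm hf = P.extMk (r • f) m hm (by simp [hf]) := by
  rw [Ext.smul_eq_comp_mk₀, extMk_comp_mk₀]
  simp

/-- Cocycles of degree `n` mapped to their classes in `Ext`. -/
noncomputable def extMkLinear {n : ℕ} :
    LinearMap.ker (Linear.leftComp R Y (P.complex.d (n + 1) n)) →ₗ[R] Abelian.Ext X Y n where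
  toFun f := P.extMk f.1 (n + 1) rfl f.2
  map_add' f g := (P.add_extMk f.1 g.1 (n + 1) rfl f.2 g.2).symm
  map_smul' r f := (P.smul_extMk r f.1 (n + 1) rfl f.2).symm

lemma extMkLinear_surjective {n : ℕ} :
    Function.Surjective (P.extMkLinear (R := R) (Y := Y) (n := n)) := fun α => by
  obtain ⟨f, hf, h⟩ := P.extMk_surjective α (n + 1) rfl
  exact ⟨⟨f, hf⟩, h⟩

/-- The homology of the complex of morphisms out of a projective resolution is `Abelian.Ext`. -/
lemma nonempty_homology_linearEquiv_ext (n : ℕ) :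
    Nonempty (((P.complex.linearYonedaObj R Y).homology n) ≃ₗ[R] Abelian.Ext X Y n) := by
  let K := P.complex.linearYonedaObj R Y
  let i := (ComplexShape.up ℕ).prev n
  let e₁ := K.homologyIsoSc' i n (n + 1) rfl (by simp) ≪≫
    (K.sc' i n (n + 1)).moduleCatHomologyIso
  let φ : LinearMap.ker (K.sc' i n (n + 1)).g.hom →ₗ[R] Abelian.Ext X Y n := P.extMkLinear
  have hφ : Function.Surjective φ := P.extMkLinear_surjective
  have hker : LinearMap.range (K.sc' i n (n + 1)).moduleCatToCycles = LinearMap.ker φ := by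
    ext ⟨f, hf⟩
    have hmem : ⟨f, hf⟩ ∈ LinearMap.range (K.sc' i n (n + 1)).moduleCatToCycles ↔
        ∃ g : P.complex.X i ⟶ Y, P.complex.d n i ≫ g = f :=
      ⟨fun ⟨g, hg⟩ => ⟨g, congrArg Subtype.val hg⟩, fun ⟨g, hg⟩ => ⟨g, Subtype.ext hg⟩⟩
    rw [hmem, LinearMap.mem_ker]
    change _ ↔ P.extMk f (n + 1) rfl hf = 0
    cases n with
    | zero =>
      refine Iff.trans ?_ (P.extMk_zero_eq_zero_iff (Y := Y) f hf).symm
      rw [P.complex.shape 0 i (by simp)]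
      exact ⟨fun ⟨g, hg⟩ => hg.symm.trans Limits.zero_comp,
        fun h => ⟨0, Limits.zero_comp.trans h.symm⟩⟩
    | succ p =>
      have hi : i + 1 = p + 1 := congrArg (· + 1) (CochainComplex.prev_nat_succ p)
      exact (P.extMk_eq_zero_iff (Y := Y) f _ rfl hf i hi).symm
  exact ⟨e₁.toLinearEquiv.trans ((Submodule.quotEquivOfEq _ _ hker).trans
    (φ.quotKerEquivOfSurjective hφ))⟩

lemma nonempty_ext_linearEquiv (X Y : ModuleCat.{u} R) (n : ℕ) :
    Nonempty (((Ext R (ModuleCat.{u} R) n).obj (Opposite.op X)).obj Y ≃ₗ[R]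
      Abelian.Ext X Y n) := by
  let P := (HasProjectiveResolution.out (Z := X)).some
  obtain ⟨e⟩ := P.nonempty_homology_linearEquiv_ext (Y := Y) n
  exact ⟨(P.isoExt n Y).toLinearEquiv.trans e⟩

end CategoryTheory.ProjectiveResolution

open RingTheory.Sequence Pointwise in
lemma ext_succ_linearEquiv_of_isSMulRegular {S : Type u} [CommRing S] (N M : ModuleCat.{u} S)
    (x : S) (hx : x ∈ Module.annihilator S N) (reg : IsSMulRegular M x) (n : ℕ)
    (h : Subsingleton (Abelian.Ext N M n)) :
    Nonempty (Abelian.Ext N M (n + 1) ≃ₗ[S]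
      Abelian.Ext N (ModuleCat.of S (QuotSMulTop x M)) n) := by
  have hS := reg.smulShortComplex_shortExact
  let δ : Abelian.Ext N (ModuleCat.of S (QuotSMulTop x M)) n →ₗ[S] Abelian.Ext N M (n + 1) :=
    hS.extClass.postcompOfLinear S N rfl
  refine ⟨(LinearEquiv.ofBijective δ ⟨?_, fun y => ?_⟩).symm⟩
  · rw [injective_iff_map_eq_zero]
    intro y hy
    obtain ⟨z, rfl⟩ := Abelian.Ext.covariant_sequence_exact₃ N hS y rfl hy
    obtain rfl : z = (0 : Abelian.Ext N M n) := Subsingleton.elim (h := h) _ _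
    exact ((Abelian.Ext.mk₀ (M.smulShortComplex x).g).postcomp N (add_zero n)).map_zero
  · refine Abelian.Ext.covariant_sequence_exact₁ N hS y ?_ rfl
    have := Abelian.Ext.postcomp_smul_id_eq_zero_of_mem_annihilator (M := M) (N := N) hx (n + 1)
    exact congrArg (fun f => f.hom y) this

open RingTheory.Sequence Pointwise in
lemma ext_linearEquiv_hom_of_isRegular {S : Type u} [CommRing S] [IsNoetherianRing S]
    [IsLocalRing S] (M : ModuleCat.{u} S) [Module.Finite S M] (rs : List S)
    (mem : ∀ x ∈ rs, x ∈ maximalIdeal S) (reg : IsRegular M rs) :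
    Nonempty (Abelian.Ext (ModuleCat.of S (ResidueField S)) M rs.length ≃ₗ[S]
      (ResidueField S →ₗ[S] (M ⧸ (Ideal.ofList rs • (⊤ : Submodule S M))))) := by
  induction rs generalizing M with
  | nil =>
    have h : Ideal.ofList ([] : List S) • (⊤ : Submodule S M) = ⊥ := by
      rw [Ideal.ofList_nil, Submodule.bot_smul]
    let e : M ≃ₗ[S] (M ⧸ (Ideal.ofList [] • (⊤ : Submodule S M))) :=
      (Submodule.quotEquivOfEqBot _ h).symm
    exact ⟨Abelian.Ext.linearEquiv₀.trans (ModuleCat.homLinearEquiv.trans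
      (LinearEquiv.congrRight e))⟩
  | cons a rs ih =>
    have hM : Nontrivial M := reg.nontrivial
    have hlt : maximalIdeal S • (⊤ : Submodule S M) < ⊤ :=
      (Submodule.top_ne_ideal_smul_of_le_jacobson_annihilator
        (IsLocalRing.maximalIdeal_le_jacobson _)).symm.lt_top
    have hann : a ∈ Module.annihilator S (ResidueField S) := by
      rw [show Module.annihilator S (ResidueField S) = maximalIdeal S from
        Ideal.annihilator_quotient]
      exact mem a List.mem_cons_self
    have hsub : Subsingleton (Abelian.Ext (ModuleCat.of S (ResidueField S)) M rs.length) :=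
      ModuleCat.subsingleton_ext_of_exists_isRegular (maximalIdeal S) _
        (by
          have : Module.Finite S (ResidueField S) :=
            inferInstanceAs (Module.Finite S (S ⧸ maximalIdeal S))
          rw [Module.support_eq_zeroLocus]
          exact subset_of_eq (by rw [show Module.annihilator S (ResidueField S) = maximalIdeal S
            from Ideal.annihilator_quotient])) M hlt _ mem reg _ (by simp)
    rw [isRegular_cons_iff] at reg
    obtain ⟨e⟩ := ext_succ_linearEquiv_of_isSMulRegular (ModuleCat.of S (ResidueField S)) M a
      hann reg.1 rs.length hsub
    obtain ⟨e'⟩ := ih (ModuleCat.of S (QuotSMulTop a M))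
      (fun x hx => mem x (List.mem_cons_of_mem _ hx)) reg.2
    exact ⟨e.trans (e'.trans (LinearEquiv.congrRight
      (Submodule.quotOfListConsSMulTopEquivQuotSMulTopInner M a rs).symm))⟩

/-- The common kernel of multiplication by the elements `a i` on `M`. -/
abbrev smulKer {S ι : Type*} [CommRing S] (a : ι → S) (M : Type*) [AddCommGroup M] [Module S M] :
    Submodule S M :=
  LinearMap.ker (LinearMap.pi fun i => LinearMap.lsmul S M (a i))

lemma mem_smulKer {S ι : Type*} [CommRing S] {a : ι → S} {M : Type*} [AddCommGroup M]
    [Module S M] {x : M} : x ∈ smulKer a M ↔ ∀ i, a i • x = 0 := by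
  simp [smulKer, funext_iff]

lemma smul_eq_zero_of_mem_smulKer {S ι : Type*} [CommRing S] {a : ι → S} {M : Type*}
    [AddCommGroup M] [Module S M] {x : M} (hx : x ∈ smulKer a M) {s : S}
    (hs : s ∈ Ideal.span (Set.range a)) : s • x = 0 := by
  induction hs using Submodule.span_induction with
  | mem s hs => obtain ⟨i, rfl⟩ := hs; exact mem_smulKer.mp hx i
  | zero => simp
  | add s t _ _ hs ht => rw [add_smul, hs, ht, add_zero]
  | smul r s _ hs => rw [smul_assoc, hs, smul_zero]

/-- Homomorphisms from the residue field are determined by the image of `1`. -/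
noncomputable def homResidueFieldEquiv {S ι : Type*} [CommRing S] [IsLocalRing S] {a : ι → S}
    (ha : Ideal.span (Set.range a) = maximalIdeal S) (M : Type*) [AddCommGroup M] [Module S M] :
    (ResidueField S →ₗ[S] M) ≃ₗ[S] smulKer a M where
  toFun f := ⟨f 1, mem_smulKer.mpr fun i => by
    have : a i • (1 : ResidueField S) = 0 := by
      rw [Algebra.smul_def, mul_one]
      exact (residue_eq_zero_iff _).mpr (ha ▸ Ideal.subset_span ⟨i, rfl⟩)
    rw [← map_smul, this, map_zero]⟩
  map_add' f g := rfl
  map_smul' r f := rfl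
  invFun x := Submodule.liftQ (maximalIdeal S) (LinearMap.toSpanSingleton S M x) fun s hs => by
    rw [LinearMap.mem_ker, LinearMap.toSpanSingleton_apply]
    exact smul_eq_zero_of_mem_smulKer x.2 (ha ▸ hs)
  left_inv f := by
    ext s
    obtain ⟨s, rfl⟩ := Submodule.mkQ_surjective _ s
    rw [Submodule.mkQ_apply, Submodule.liftQ_apply, LinearMap.toSpanSingleton_apply]
    rw [← map_smul, Algebra.smul_def, mul_one]
    rfl
  right_inv x := Subtype.ext <| by
    change LinearMap.toSpanSingleton S M x 1 = x
    simp

open TensorProduct in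
lemma length_smulKer_baseChange {A B ι : Type*} [CommRing A] [CommRing B] [Algebra A B]
    [Module.Flat A B] [Finite ι] (a : ι → A) (M : Type*) [AddCommGroup M] [Module A M] :
    Module.length B (smulKer (fun i => algebraMap A B (a i)) (B ⊗[A] M)) =
      Module.length B (B ⊗[A] smulKer a M) := by
  classical
  have := Fintype.ofFinite ι
  let φ : M →ₗ[A] (ι → M) := LinearMap.pi fun i => LinearMap.lsmul A M (a i)
  have hinj : Function.Injective ((smulKer a M).subtype.baseChange B) :=
    Module.Flat.lTensor_preserves_injective_linearMap _ (Submodule.injective_subtype _)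
  have hexact : Function.Exact ((smulKer a M).subtype.baseChange B) (φ.baseChange B) :=
    Module.Flat.lTensor_exact B (LinearMap.exact_subtype_ker_map φ)
  have hφ (z : B ⊗[A] M) (i : ι) :
      TensorProduct.piRight A B B (fun _ : ι => M) (φ.baseChange B z) i =
        algebraMap A B (a i) • z := by
    induction z with
    | zero => simp
    | add x y hx hy => simp only [map_add, Pi.add_apply, hx, hy, smul_add]
    | tmul b m => simp [φ, TensorProduct.smul_tmul']
  have hker : LinearMap.range ((smulKer a M).subtype.baseChange B) =
      smulKer (fun i => algebraMap A B (a i)) (B ⊗[A] M) := by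
    ext z
    rw [LinearMap.mem_range, ← Set.mem_range, ← hexact z, mem_smulKer,
      ← (TensorProduct.piRight A B B (fun _ : ι => M)).map_eq_zero_iff, funext_iff]
    simp only [hφ, Pi.zero_apply]
  rw [← hker]
  exact (LinearEquiv.ofInjective _ hinj).length_eq.symm

open TensorProduct in
lemma length_hom_residueField_baseChange {A B : Type*} [CommRing A] [CommRing B] [IsLocalRing A]
    [IsNoetherianRing A] [IsLocalRing B] [Algebra A B] [Module.Flat A B]
    (h : (maximalIdeal A).map (algebraMap A B) = maximalIdeal B)
    (M : Type*) [AddCommGroup M] [Module A M] :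
    Module.length B (ResidueField B →ₗ[B] B ⊗[A] M) =
      Module.length A (ResidueField A →ₗ[A] M) := by
  obtain ⟨n, a, ha⟩ := Submodule.fg_iff_exists_fin_generating_family.mp
    (IsNoetherian.noetherian (maximalIdeal A))
  have ha' : Ideal.span (Set.range fun i => algebraMap A B (a i)) = maximalIdeal B := by
    rw [← h, ← ha, Ideal.map_span, ← Set.range_comp]
    rfl
  have : IsLocalHom (algebraMap A B) := ((local_hom_TFAE _).out 0 2).mpr h.le
  rw [(homResidueFieldEquiv ha' _).length_eq, (homResidueFieldEquiv ha _).length_eq,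
    length_smulKer_baseChange, IsLocalRing.length_baseChange, h]
  have : Module.length B (B ⧸ maximalIdeal B) = 1 :=
    Module.length_eq_one_iff.mpr (isSimpleModule_iff_isCoatom.mpr (maximalIdeal.isMaximal B).out)
  rw [this, mul_one]

lemma length_quotient_map {A B : Type*} [CommRing A] [CommRing B] [IsLocalRing A]
    [IsLocalRing B] [Algebra A B] [Module.Flat A B]
    (h : (maximalIdeal A).map (algebraMap A B) = maximalIdeal B) (I : Ideal A) :
    Module.length B (B ⧸ I.map (algebraMap A B)) = Module.length A (A ⧸ I) := by
  have : IsLocalHom (algebraMap A B) := ((local_hom_TFAE _).out 0 2).mpr h.le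
  rw [(Algebra.TensorProduct.quotIdealMapEquivTensorQuot B I).toLinearEquiv.length_eq,
    IsLocalRing.length_baseChange, h]
  have : Module.length B (B ⧸ maximalIdeal B) = 1 :=
    Module.length_eq_one_iff.mpr (isSimpleModule_iff_isCoatom.mpr (maximalIdeal.isMaximal B).out)
  rw [this, mul_one]

/-- The length of the socle of `S ⧸ I` is the difference of the colengths of `I` and `I : 𝔪`. -/
lemma length_hom_residueField_quotient {S : Type*} [CommRing S] [IsLocalRing S] (I J : Ideal S)
    (hJ : ∀ b, b ∈ J ↔ ∀ a ∈ maximalIdeal S, a * b ∈ I) :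
    Module.length S (S ⧸ I) =
      Module.length S (ResidueField S →ₗ[S] S ⧸ I) + Module.length S (S ⧸ J) := by
  have hspan : Ideal.span (Set.range ((↑) : maximalIdeal S → S)) = maximalIdeal S := by
    rw [Subtype.range_coe]
    exact Ideal.span_eq _
  rw [(homResidueFieldEquiv hspan (S ⧸ I)).length_eq]
  have hIJ : I ≤ J := fun b hb => (hJ b).mpr fun a _ => I.mul_mem_left a hb
  refine Module.length_eq_add_of_exact (Submodule.subtype _) (Submodule.factor hIJ)
    (Submodule.injective_subtype _) (Submodule.factor_surjective hIJ) fun z => ?_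
  obtain ⟨b, rfl⟩ := Submodule.mkQ_surjective _ z
  have hz : Submodule.factor hIJ (Submodule.mkQ I b) = Submodule.mkQ J b := rfl
  rw [hz, Submodule.coe_subtype, Subtype.range_coe, SetLike.mem_coe, mem_smulKer,
    Submodule.mkQ_apply, Submodule.Quotient.mk_eq_zero, hJ, Subtype.forall]
  refine forall₂_congr fun a ha => ?_
  rw [Submodule.mkQ_apply, ← Submodule.Quotient.mk_smul, Submodule.Quotient.mk_eq_zero,
    smul_eq_mul]

lemma mem_of_subsingleton_hom_residueField {S : Type*} [CommRing S] [IsLocalRing S] (I : Ideal S)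
    [Subsingleton (ResidueField S →ₗ[S] S ⧸ I)] {b : S}
    (hb : ∀ a ∈ maximalIdeal S, a * b ∈ I) : b ∈ I := by
  have hspan : Ideal.span (Set.range ((↑) : maximalIdeal S → S)) = maximalIdeal S := by
    rw [Subtype.range_coe]
    exact Ideal.span_eq _
  have hmem : Submodule.mkQ I b ∈ smulKer ((↑) : maximalIdeal S → S) (S ⧸ I) := by
    rw [mem_smulKer]
    intro a
    rw [Submodule.mkQ_apply, ← Submodule.Quotient.mk_smul, Submodule.Quotient.mk_eq_zero]
    exact hb a a.2
  have : Subsingleton (smulKer ((↑) : maximalIdeal S → S) (S ⧸ I)) :=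
    (homResidueFieldEquiv hspan (S ⧸ I)).symm.injective.subsingleton
  have h0 : Submodule.mkQ I b = 0 :=
    congrArg Subtype.val (Subsingleton.elim (⟨_, hmem⟩ : smulKer _ (S ⧸ I)) 0)
  rwa [Submodule.mkQ_apply, Submodule.Quotient.mk_eq_zero] at h0

/-- A Noetherian local ring has a flat local extension with infinite residue field whose maximal
ideal is extended. -/
lemma exists_flat_infinite_residueField (R : Type u) [CommRing R] [IsNoetherianRing R]
    [IsLocalRing R] :
    ∃ (S : Type u) (_ : CommRing S) (_ : IsNoetherianRing S) (_ : IsLocalRing S) (_ : Algebra R S),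
      Module.Flat R S ∧ (maximalIdeal R).map (algebraMap R S) = maximalIdeal S ∧
        Infinite (ResidueField S) := by
  let P : Ideal (Polynomial R) := (maximalIdeal R).map Polynomial.C
  have : P.IsPrime := Ideal.isPrime_map_C_of_isPrime
  let S := Localization.AtPrime P
  have hmap : (maximalIdeal R).map (algebraMap R S) = maximalIdeal S := by
    rw [IsScalarTower.algebraMap_eq R (Polynomial R) S, ← Ideal.map_map]
    exact Localization.AtPrime.map_eq_maximalIdeal
  refine ⟨S, inferInstance, IsLocalization.isNoetherianRing P.primeCompl S inferInstance,
    inferInstance, inferInstance, ?_, hmap, ?_⟩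
  · have : Module.Flat (Polynomial R) S := IsLocalization.flat S P.primeCompl
    exact Module.Flat.trans R (Polynomial R) S
  · refine Infinite.of_injective
      (fun n : ℕ => residue S (algebraMap (Polynomial R) S (Polynomial.X ^ n))) fun i j hij => ?_
    by_contra hne
    have h1 : (Polynomial.X ^ i - Polynomial.X ^ j : Polynomial R) ∈ P := by
      rw [← IsLocalization.AtPrime.to_map_mem_maximal_iff S P, map_sub,
        ← residue_eq_zero_iff, map_sub, sub_eq_zero]
      exact hij
    have h2 := Ideal.mem_map_C_iff.mp h1 i
    simp [Polynomial.coeff_X_pow, hne] at h2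

/-- A module over a local ring with infinite residue field is not a finite union of proper
submodules. -/
lemma exists_notMem_of_infinite_residueField {S M : Type*} [CommRing S] [IsLocalRing S]
    [Infinite (ResidueField S)] [AddCommGroup M] [Module S M] (t : Finset (Submodule S M))
    (ht : ⊤ ∉ t) : ∃ x, ∀ V ∈ t, x ∉ V := by
  by_contra! h
  have hcov : ⋃ V ∈ t, (id V : Set M) = Set.univ :=
    Set.eq_univ_of_forall fun x => by simpa using h x
  obtain ⟨V, hV, hfi⟩ := Submodule.exists_finiteIndex_of_cover hcov
  have hfin : Finite (M ⧸ V) := AddSubgroup.finite_quotient_of_finiteIndex (H := V.toAddSubgroup)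
  have : Nontrivial (M ⧸ V) :=
    Submodule.Quotient.nontrivial_iff.mpr (ne_of_mem_of_not_mem hV ht)
  obtain ⟨y, hy⟩ := exists_ne (0 : M ⧸ V)
  have hne : LinearMap.ker (LinearMap.toSpanSingleton S _ y) ≠ ⊤ := fun htop => hy <| by
    have : (1 : S) ∈ LinearMap.ker (LinearMap.toSpanSingleton S _ y) := htop ▸ Submodule.mem_top
    simpa using this
  have hker : LinearMap.ker (LinearMap.toSpanSingleton S _ y) ≤ maximalIdeal S :=
    le_maximalIdeal hne
  refine not_injective_infinite_finite
    (fun z : ResidueField S => (Function.surjInv residue_surjective z) • y) fun a b hab => ?_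
  have hmem : Function.surjInv residue_surjective a - Function.surjInv residue_surjective b ∈
      maximalIdeal S := hker <| by
    rw [LinearMap.mem_ker, LinearMap.toSpanSingleton_apply, sub_smul]
    exact sub_eq_zero.mpr hab
  rw [← residue_eq_zero_iff, map_sub, Function.surjInv_eq residue_surjective,
    Function.surjInv_eq residue_surjective] at hmem
  exact sub_eq_zero.mp hmem

/-- If `φ x` avoids the radicals of the primary components of `J` not containing the image
of `φ`, then it is a nonzerodivisor modulo `J` on a large power of the ideal generated by this
image. -/
lemma exists_finset_forall_mul_mem {S A M : Type*} [CommRing S] [CommRing A] [IsNoetherianRing A]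
    [Algebra S A] [AddCommGroup M] [Module S M] (φ : M →ₗ[S] A) (J : Ideal A) :
    ∃ t : Finset (Submodule S M), ⊤ ∉ t ∧ ∃ c : ℕ, ∀ x, (∀ V ∈ t, x ∉ V) →
      ∀ b ∈ Ideal.span (Set.range φ) ^ c, φ x * b ∈ J → b ∈ J := by
  classical
  obtain ⟨s, hs, hprim⟩ := Submodule.isLasker A A J
  have hJ (b : A) : b ∈ J ↔ ∀ q ∈ s, b ∈ q := by
    rw [← hs, Submodule.mem_finsetInf]; rfl
  let V (q : Ideal A) : Submodule S M := ((Ideal.radical q).restrictScalars S).comap φ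
  have hpow : ∃ c : ℕ, ∀ q ∈ s, V q = ⊤ → Ideal.span (Set.range φ) ^ c ≤ q := by
    have h (q : Ideal A) : ∃ c : ℕ, V q = ⊤ → Ideal.span (Set.range φ) ^ c ≤ q := by
      by_cases hq : V q = ⊤
      · have hle : Ideal.span (Set.range φ) ≤ Ideal.radical q := by
          rw [Ideal.span_le]
          rintro _ ⟨x, rfl⟩
          have : x ∈ V q := hq ▸ Submodule.mem_top
          exact this
        obtain ⟨c, hc⟩ := Ideal.exists_pow_le_of_le_radical_of_fg hle (IsNoetherian.noetherian _)
        exact ⟨c, fun _ => hc⟩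
      · exact ⟨0, fun h => absurd h hq⟩
    choose c hc using h
    exact ⟨s.sup c, fun q hq htop => (Ideal.pow_le_pow_right (Finset.le_sup hq)).trans (hc q htop)⟩
  obtain ⟨c, hc⟩ := hpow
  refine ⟨(s.image V).erase ⊤, Finset.notMem_erase _ _, c, fun x hx b hb hxb => ?_⟩
  rw [hJ] at hxb ⊢
  intro q hq
  by_cases htop : V q = ⊤
  · exact hc q hq htop hb
  · have hxq : φ x ∉ Ideal.radical q :=
      hx (V q) (Finset.mem_erase.mpr ⟨htop, Finset.mem_image_of_mem V hq⟩)
    exact ((Ideal.isPrimary_iff.mp (hprim hq)).2 (mul_comm (φ x) b ▸ hxb q hq)).resolve_right hxq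

open Polynomial in
/-- The multiplication by the degree one part of the Rees algebra, as a linear map. -/
noncomputable def reesAlgebraOne {S : Type*} [CommRing S] (n : Ideal S) :
    n →ₗ[S] reesAlgebra n where
  toFun a := ⟨monomial 1 (a : S), reesAlgebra.monomial_mem.mpr (by simp)⟩
  map_add' a b := Subtype.ext (by simp)
  map_smul' s a := Subtype.ext (by simp [smul_monomial])

open Polynomial in
lemma exists_mem_span_range_reesAlgebraOne_pow {S : Type*} [CommRing S] (n : Ideal S) (m : ℕ)
    {b : S} (hb : b ∈ n ^ m) :
    ∃ f ∈ Ideal.span (Set.range (reesAlgebraOne n)) ^ m, (f : S[X]) = monomial m b := by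
  induction m generalizing b with
  | zero => exact ⟨algebraMap S _ b, by simp, rfl⟩
  | succ m ih =>
    rw [pow_succ'] at hb
    refine Submodule.mul_induction_on hb (fun a ha b hb => ?_) ?_
    · obtain ⟨f, hf, hfb⟩ := ih hb
      refine ⟨reesAlgebraOne n ⟨a, ha⟩ * f, ?_, ?_⟩
      · rw [pow_succ']
        exact Ideal.mul_mem_mul (Ideal.subset_span ⟨_, rfl⟩) hf
      · rw [Subalgebra.coe_mul, hfb]
        change monomial 1 a * monomial m b = _
        rw [monomial_mul_monomial, add_comm]
    · rintro a b ⟨f, hf, hfa⟩ ⟨g, hg, hgb⟩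
      exact ⟨f + g, add_mem hf hg, by rw [Subalgebra.coe_add, hfa, hgb, map_add]⟩

open Polynomial in
/-- The ideal of the Rees algebra of `n` presenting the associated graded ring of `S ⧸ I`. -/
noncomputable def reesAlgebraIdeal {S : Type*} [CommRing S] (n I : Ideal S) :
    Ideal (reesAlgebra n) where
  carrier := {f | ∀ m, (f : S[X]).coeff m ∈ I ⊔ n ^ (m + 1)}
  add_mem' hf hg m := by
    rw [Subalgebra.coe_add, coeff_add]
    exact add_mem (hf m) (hg m)
  zero_mem' m := by simp
  smul_mem' g f hf m := by
    rw [smul_eq_mul, Subalgebra.coe_mul, coeff_mul]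
    refine sum_mem fun ij hij => ?_
    have hle : n ^ ij.1 * (I ⊔ n ^ (ij.2 + 1)) ≤ I ⊔ n ^ (m + 1) := by
      rw [Ideal.mul_sup, ← pow_add, ← add_assoc, Finset.HasAntidiagonal.mem_antidiagonal.mp hij]
      exact sup_le_sup_right Ideal.mul_le_right _
    exact hle (Ideal.mul_mem_mul ((mem_reesAlgebra_iff n _).mp g.2 _) (hf _))

open Polynomial in
lemma monomial_mem_reesAlgebraIdeal {S : Type*} [CommRing S] {n I : Ideal S} {m : ℕ} {b : S}
    {f : reesAlgebra n} (hf : (f : S[X]) = monomial m b) :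
    f ∈ reesAlgebraIdeal n I ↔ b ∈ I ⊔ n ^ (m + 1) := by
  change (∀ i, (f : S[X]).coeff i ∈ I ⊔ n ^ (i + 1)) ↔ _
  refine ⟨fun h => by simpa [hf] using h m, fun h i => ?_⟩
  rw [hf, coeff_monomial]
  split_ifs with hi
  · rwa [← hi]
  · exact zero_mem _

open Polynomial in
lemma exists_finset_forall_mem_sup_pow {S : Type*} [CommRing S] [IsNoetherianRing S]
    (n I : Ideal S) :
    ∃ t : Finset (Submodule S n), ⊤ ∉ t ∧ ∃ c : ℕ, ∀ x : n, (∀ V ∈ t, x ∉ V) → ∀ m ≥ c,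
      ∀ b ∈ n ^ m, x * b ∈ I ⊔ n ^ (m + 2) → b ∈ I ⊔ n ^ (m + 1) := by
  obtain ⟨t, ht, c, hc⟩ := exists_finset_forall_mul_mem (reesAlgebraOne n) (reesAlgebraIdeal n I)
  refine ⟨t, ht, c, fun x hx m hm b hb hxb => ?_⟩
  obtain ⟨f, hf, hfb⟩ := exists_mem_span_range_reesAlgebraOne_pow n m hb
  rw [← monomial_mem_reesAlgebraIdeal hfb]
  refine hc x hx f (Ideal.pow_le_pow_right hm hf) ?_
  rw [monomial_mem_reesAlgebraIdeal (m := m + 1) (b := x * b)]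
  · exact hxb
  · rw [Subalgebra.coe_mul, hfb]
    change monomial 1 (x : S) * monomial m b = _
    rw [monomial_mul_monomial, add_comm]

/-- An Artin–Rees estimate for division by an element which is regular modulo `I`. -/
lemma exists_forall_mem_sup_pow_sub {S : Type*} [CommRing S] [IsNoetherianRing S]
    (n I : Ideal S) {x : S} (hx : ∀ b, x * b ∈ I → b ∈ I) :
    ∃ k : ℕ, ∀ m ≥ k, ∀ b, x * b ∈ I ⊔ n ^ m → b ∈ I ⊔ n ^ (m - k) := by
  obtain ⟨k, hk⟩ := Ideal.exists_pow_inf_eq_pow_smul n (I ⊔ Ideal.span {x})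
  refine ⟨k, fun m hm b hb => ?_⟩
  obtain ⟨i, hi, z, hz, hiz⟩ := Submodule.mem_sup.mp hb
  have hzN : z ∈ I ⊔ Ideal.span {x} := by
    rw [show z = -i + x * b by rw [← hiz]; ring]
    exact Submodule.add_mem_sup (neg_mem hi)
      (Ideal.mul_mem_right _ _ (Ideal.mem_span_singleton_self x))
  have hz' : z ∈ n ^ (m - k) • (n ^ k • (⊤ : Submodule S S) ⊓ (I ⊔ Ideal.span {x})) := by
    rw [← hk m hm]
    exact ⟨by simpa using hz, hzN⟩
  have hle : n ^ (m - k) • (n ^ k • (⊤ : Submodule S S) ⊓ (I ⊔ Ideal.span {x})) ≤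
      I ⊔ n ^ (m - k) * Ideal.span {x} := by
    refine (smul_mono_right _ inf_le_right).trans ?_
    rw [smul_eq_mul, Ideal.mul_sup]
    exact sup_le_sup_right Ideal.mul_le_right _
  obtain ⟨i', hi', y, hy, hiy⟩ := Submodule.mem_sup.mp (hle hz')
  obtain ⟨w, hw, rfl⟩ := Ideal.mem_mul_span_singleton.mp hy
  have hbw : b - w ∈ I := hx _ <| by
    rw [show x * (b - w) = i + i' by rw [mul_sub, ← hiz, ← hiy]; ring]
    exact add_mem hi hi'
  rw [← sub_add_cancel b w]
  exact Submodule.add_mem_sup hbw hw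

/-- Existence of superficial elements: if the socle of `S ⧸ I` vanishes and the residue field is
infinite, there is a minimal generator of the maximal ideal of `S ⧸ I` which is a regular
superficial element. -/
lemma exists_superficial {S : Type*} [CommRing S] [IsNoetherianRing S] [IsLocalRing S]
    [Infinite (ResidueField S)] (I : Ideal S) (hI : I ≤ maximalIdeal S)
    (hsoc : ∀ b, (∀ a ∈ maximalIdeal S, a * b ∈ I) → b ∈ I) :
    ∃ x ∈ maximalIdeal S, x ∉ I ⊔ maximalIdeal S ^ 2 ∧ (∀ b, x * b ∈ I → b ∈ I) ∧
      ∃ N : ℕ, ∀ m ≥ N, ∀ b, x * b ∈ I ⊔ maximalIdeal S ^ (m + 1) →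
        b ∈ I ⊔ maximalIdeal S ^ m := by
  classical
  set n := maximalIdeal S with hn
  obtain ⟨t₁, ht₁, c₁, hc₁⟩ := exists_finset_forall_mul_mem (Submodule.subtype n) I
  obtain ⟨t₂, ht₂, c₂, hc₂⟩ := exists_finset_forall_mem_sup_pow n I
  let W : Submodule S n := Submodule.comap (Submodule.subtype n) (I ⊔ n ^ 2)
  have hW : W ≠ ⊤ := fun hW => by
    have hle : n ≤ I ⊔ n • n := by
      rw [smul_eq_mul, ← pow_two]
      exact Submodule.comap_subtype_eq_top.mp hW
    have hle' : n ≤ I := Submodule.le_of_le_smul_of_le_jacobson_bot (IsNoetherian.noetherian n)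
      (maximalIdeal_le_jacobson _) hle
    have h1 : (1 : S) ∈ I := hsoc 1 fun a ha => by rw [mul_one]; exact hle' ha
    exact (Ideal.ne_top_iff_one _).mp (maximalIdeal.isMaximal S).ne_top (hI h1)
  obtain ⟨x, hx⟩ := exists_notMem_of_infinite_residueField (insert W (t₁ ∪ t₂)) (by
    simp only [Finset.mem_insert, Finset.mem_union]
    rintro (h | h | h)
    exacts [hW h.symm, ht₁ h, ht₂ h])
  have hrange : Ideal.span (Set.range (Submodule.subtype n)) = n := by
    rw [Submodule.coe_subtype, Subtype.range_coe]
    exact Ideal.span_eq n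
  have hpow (c : ℕ) : ∀ b, (∀ a ∈ n ^ c, a * b ∈ I) → b ∈ I := by
    induction c with
    | zero => exact fun b hb => by simpa using hb 1 (by simp)
    | succ c ih =>
      refine fun b hb => ih b fun a ha => hsoc _ fun a' ha' => ?_
      rw [← mul_assoc]
      exact hb _ (by rw [pow_succ']; exact Ideal.mul_mem_mul ha' ha)
  have hreg : ∀ b, (x : S) * b ∈ I → b ∈ I := fun b hb => hpow c₁ b fun a ha => by
    refine hc₁ x (fun V hV => hx V (by simp [hV])) _ ?_ ?_
    · rw [hrange]
      exact Ideal.mul_mem_right _ _ ha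
    · rw [Submodule.subtype_apply, mul_left_comm]
      exact I.mul_mem_left _ hb
  refine ⟨x, x.2, fun h => hx W (Finset.mem_insert_self _ _) h, hreg, ?_⟩
  obtain ⟨k, hk⟩ := exists_forall_mem_sup_pow_sub n I hreg
  refine ⟨c₂ + k, fun m hm b hb => ?_⟩
  have key (j : ℕ) : m + 1 - k + j ≤ m → b ∈ I ⊔ n ^ (m + 1 - k + j) := by
    induction j with
    | zero => exact fun _ => hk (m + 1) (by omega) b hb
    | succ j ih =>
      intro hj
      obtain ⟨i, hi, b', hb', rfl⟩ := Submodule.mem_sup.mp (ih (by omega))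
      refine add_mem (Ideal.mem_sup_left hi) ?_
      have hj' : m + 1 - k + j ≥ c₂ := by omega
      refine hc₂ x (fun V hV => hx V (by simp [hV])) _ hj' b' hb' ?_
      have hle : I ⊔ n ^ (m + 1) ≤ I ⊔ n ^ (m + 1 - k + j + 2) :=
        sup_le_sup_left (Ideal.pow_le_pow_right (by omega)) _
      rw [show (x : S) * b' = x * (i + b') - x * i by ring]
      exact sub_mem (hle hb) (Ideal.mem_sup_left (I.mul_mem_left _ hi))
  rcases Nat.eq_zero_or_pos k with rfl | hk0
  · have hle : I ⊔ n ^ (m + 1) ≤ I ⊔ n ^ m := sup_le_sup_left (Ideal.pow_le_pow_right (by omega)) _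
    exact hle (hk (m + 1) (by omega) b hb)
  · have := key (k - 1) (by omega)
    rwa [show m + 1 - k + (k - 1) = m by omega] at this

lemma Module.length_quotient_of_mul_mem {S : Type*} [CommRing S] {J K L : Ideal S} {x : S}
    (hK : ∀ b, b ∈ K ↔ x * b ∈ J) (hL : L = J ⊔ Ideal.span {x}) :
    Module.length S (S ⧸ J) = Module.length S (S ⧸ K) + Module.length S (S ⧸ L) := by
  have hJL : J ≤ L := hL ▸ le_sup_left
  let f : (S ⧸ K) →ₗ[S] S ⧸ J :=
    Submodule.mapQ K J (LinearMap.mulLeft S x) fun b hb => (hK b).mp hb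
  have hf (b : S) : f (Submodule.mkQ K b) = Submodule.mkQ J (x * b) := rfl
  refine Module.length_eq_add_of_exact f (Submodule.factor hJL) ?_
    (Submodule.factor_surjective hJL) fun z => ?_
  · rw [injective_iff_map_eq_zero]
    intro z hz
    obtain ⟨b, rfl⟩ := Submodule.mkQ_surjective _ z
    rw [hf, Submodule.mkQ_apply, Submodule.Quotient.mk_eq_zero, ← hK] at hz
    rwa [Submodule.mkQ_apply, Submodule.Quotient.mk_eq_zero]
  · obtain ⟨b, rfl⟩ := Submodule.mkQ_surjective _ z
    have hz : Submodule.factor hJL (Submodule.mkQ J b) = Submodule.mkQ L b := rfl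
    rw [hz, Submodule.mkQ_apply, Submodule.Quotient.mk_eq_zero, hL]
    constructor
    · intro hb
      obtain ⟨j, hj, y, hy, rfl⟩ := Submodule.mem_sup.mp hb
      obtain ⟨c, rfl⟩ := Ideal.mem_span_singleton'.mp hy
      refine ⟨Submodule.mkQ K c, ?_⟩
      rw [hf, Submodule.mkQ_apply, Submodule.mkQ_apply, Submodule.Quotient.eq]
      rw [show x * c - (j + c * x) = -j by ring]
      exact neg_mem hj
    · rintro ⟨w, hw⟩
      obtain ⟨c, rfl⟩ := Submodule.mkQ_surjective _ w
      rw [hf, Submodule.mkQ_apply, Submodule.mkQ_apply, Submodule.Quotient.eq] at hw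
      rw [show b = -(x * c - b) + c * x by ring]
      exact Submodule.add_mem_sup (neg_mem hw) (Ideal.mem_span_singleton'.mpr ⟨c, rfl⟩)

lemma length_quotient_maximalIdeal (S : Type*) [CommRing S] [IsLocalRing S] :
    Module.length S (S ⧸ maximalIdeal S) = 1 :=
  Module.length_eq_one_iff.mpr (isSimpleModule_iff_isCoatom.mpr (maximalIdeal.isMaximal S).out)

lemma isRegular_append_singleton {S : Type*} [CommRing S] [IsLocalRing S] {xs : List S} {x : S}
    (hxs : ∀ y ∈ xs, y ∈ maximalIdeal S) (hreg : RingTheory.Sequence.IsRegular S xs)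
    (hxm : x ∈ maximalIdeal S) (hx : ∀ b, x * b ∈ Ideal.ofList xs → b ∈ Ideal.ofList xs) :
    RingTheory.Sequence.IsRegular S (xs ++ [x]) := by
  rw [isRegular_iff_isWeaklyRegular_of_subset_maximalIdeal (by
    simpa [or_imp, forall_and] using ⟨hxs, hxm⟩), RingTheory.Sequence.isWeaklyRegular_append_iff,
    RingTheory.Sequence.isWeaklyRegular_singleton_iff, isSMulRegular_quotient_iff_mem_of_smul_mem]
  refine ⟨hreg.toIsWeaklyRegular, ?_⟩
  simpa using hx

lemma nonempty_ext_linearEquiv_hom_quotient {S : Type u} [CommRing S] [IsNoetherianRing S]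
    [IsLocalRing S] {xs : List S} (hxs : ∀ y ∈ xs, y ∈ maximalIdeal S)
    (hreg : RingTheory.Sequence.IsRegular S xs) {d : ℕ} (hd : xs.length = d) :
    Nonempty (Abelian.Ext (ModuleCat.of S (ResidueField S)) (ModuleCat.of S S) d
      ≃ₗ[S] (ResidueField S →ₗ[S] S ⧸ Ideal.ofList xs)) := by
  subst hd
  have : Module.Finite S (ModuleCat.of S S) := inferInstanceAs (Module.Finite S S)
  have e : Nonempty (Abelian.Ext (ModuleCat.of S (ResidueField S)) (ModuleCat.of S S) xs.length
      ≃ₗ[S] (ResidueField S →ₗ[S] S ⧸ (Ideal.ofList xs • (⊤ : Submodule S S)))) :=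
    ext_linearEquiv_hom_of_isRegular (ModuleCat.of S S) xs hxs hreg
  rwa [smul_eq_mul, Ideal.mul_top] at e

lemma subsingleton_hom_residueField_quotient {S : Type u} [CommRing S] [IsNoetherianRing S]
    [IsLocalRing S] {rs : List S} (hrs : ∀ y ∈ rs, y ∈ maximalIdeal S)
    (hreg : RingTheory.Sequence.IsRegular S rs) {xs : List S}
    (hxs : ∀ y ∈ xs, y ∈ maximalIdeal S) (hreg' : RingTheory.Sequence.IsRegular S xs)
    (hlt : xs.length < rs.length) :
    Subsingleton (ResidueField S →ₗ[S] S ⧸ Ideal.ofList xs) := by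
  have hfin : Module.Finite S (ModuleCat.of S S) := inferInstanceAs (Module.Finite S S)
  have hfin' : Module.Finite S (ModuleCat.of S (ResidueField S)) :=
    inferInstanceAs (Module.Finite S (ResidueField S))
  have hext : Subsingleton
      (Abelian.Ext (ModuleCat.of S (ResidueField S)) (ModuleCat.of S S) xs.length) := by
    refine ModuleCat.subsingleton_ext_of_exists_isRegular (maximalIdeal S) _ ?_ _ ?_ rs hrs hreg _
      hlt
    · intro p hp s hs
      refine Module.annihilator_le_of_mem_support hp (Module.mem_annihilator.mpr fun z => ?_)
      obtain ⟨z, rfl⟩ := residue_surjective z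
      change s • residue S z = 0
      rw [Algebra.smul_def]
      exact mul_eq_zero_of_left ((residue_eq_zero_iff _).mpr hs) _
    · change maximalIdeal S • (⊤ : Submodule S S) < ⊤
      rw [smul_eq_mul, Ideal.mul_top]
      exact (maximalIdeal.isMaximal S).ne_top.lt_top
  obtain ⟨e⟩ := nonempty_ext_linearEquiv_hom_quotient hxs hreg' rfl
  exact e.symm.injective.subsingleton

/-- In a Cohen–Macaulay local ring with infinite residue field, there are superficial regular
sequences of any length up to the dimension. -/
lemma exists_superficial_sequence {S : Type u} [CommRing S] [IsNoetherianRing S]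
    [IsLocalRing S] [Infinite (ResidueField S)] {rs : List S}
    (hrs : ∀ y ∈ rs, y ∈ maximalIdeal S) (hreg : RingTheory.Sequence.IsRegular S rs)
    (f : ℚ → ℚ) (N : ℕ) (hf : ∀ m ≥ N, ∃ l : ℕ,
      Module.length S (S ⧸ maximalIdeal S ^ m) = l ∧ (l : ℚ) = f m)
    (j : ℕ) (hj : j ≤ rs.length) :
    ∃ xs : List S, xs.length = j ∧ (∀ y ∈ xs, y ∈ maximalIdeal S) ∧
      RingTheory.Sequence.IsRegular S xs ∧
      Module.length S (S ⧸ Ideal.ofList xs ⊔ maximalIdeal S ^ 2) + j =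
        Module.length S (S ⧸ maximalIdeal S ^ 2) ∧
      ∃ N : ℕ, ∀ m ≥ N, ∃ l : ℕ,
        Module.length S (S ⧸ Ideal.ofList xs ⊔ maximalIdeal S ^ m) = l ∧
          (l : ℚ) = (fwdDiff 1)^[j] f (m - j) := by
  induction j with
  | zero =>
    refine ⟨[], rfl, by simp, ⟨RingTheory.Sequence.IsWeaklyRegular.nil S S, by simp⟩, ?_, N, ?_⟩
    · rw [Ideal.ofList_nil, bot_sup_eq]; simp
    · rw [Ideal.ofList_nil]
      intro m hm
      rw [bot_sup_eq]
      simpa using hf m hm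
  | succ j ih =>
    obtain ⟨xs, hlen, hxs, hreg', hlen2, N, hN⟩ := ih (by omega)
    have hI : Ideal.ofList xs ≤ maximalIdeal S := Ideal.span_le.mpr hxs
    have := subsingleton_hom_residueField_quotient hrs hreg hxs hreg' (by omega)
    obtain ⟨x, hxm, hx2, hxreg, N', hN'⟩ := exists_superficial (Ideal.ofList xs) hI
      fun b => mem_of_subsingleton_hom_residueField (Ideal.ofList xs)
    have hsup (m : ℕ) : Ideal.ofList (xs ++ [x]) ⊔ maximalIdeal S ^ m =
        (Ideal.ofList xs ⊔ maximalIdeal S ^ m) ⊔ Ideal.span {x} := by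
      rw [Ideal.ofList_append, Ideal.ofList_singleton, sup_right_comm]
    refine ⟨xs ++ [x], by simp [hlen], by simpa [or_imp, forall_and] using ⟨hxs, hxm⟩,
      isRegular_append_singleton hxs hreg' hxm hxreg, ?_, max N N' + 1, fun m hm => ?_⟩
    · have hK : ∀ b, b ∈ maximalIdeal S ↔ x * b ∈ Ideal.ofList xs ⊔ maximalIdeal S ^ 2 := by
        refine fun b => ⟨fun hb => Ideal.mem_sup_right ?_, fun hb => ?_⟩
        · rw [pow_two]; exact Ideal.mul_mem_mul hxm hb
        · by_contra hb'
          exact hx2 ((Ideal.mul_unit_mem_iff_mem _ (not_not.mp hb')).mp hb)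
      rw [← hlen2, Module.length_quotient_of_mul_mem hK (hsup 2), length_quotient_maximalIdeal]
      push_cast
      ring
    · obtain ⟨m, rfl⟩ : ∃ m', m = m' + 1 := ⟨m - 1, by omega⟩
      obtain ⟨l, hl, hlf⟩ := hN m (by omega)
      obtain ⟨l', hl', hlf'⟩ := hN (m + 1) (by omega)
      have hK : ∀ b, b ∈ Ideal.ofList xs ⊔ maximalIdeal S ^ m ↔
          x * b ∈ Ideal.ofList xs ⊔ maximalIdeal S ^ (m + 1) := by
        refine fun b => ⟨fun hb => ?_, hN' m (by omega) b⟩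
        obtain ⟨i, hi, z, hz, rfl⟩ := Submodule.mem_sup.mp hb
        rw [mul_add]
        exact Submodule.add_mem_sup (Ideal.mul_mem_left _ _ hi)
          (by rw [pow_succ']; exact Ideal.mul_mem_mul hxm hz)
      have hadd := Module.length_quotient_of_mul_mem hK (hsup (m + 1))
      rw [hl, hl'] at hadd
      obtain ⟨l'', hl''⟩ := ENat.ne_top_iff_exists.mp
        (ne_top_of_le_ne_top (ENat.natCast_ne_top l') (hadd ▸ le_add_self))
      rw [← hl''] at hadd ⊢
      refine ⟨l'', rfl, ?_⟩
      have hadd' : l' = l + l'' := by exact_mod_cast hadd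
      rw [Function.iterate_succ_apply', fwdDiff]
      have hq : (l'' : ℚ) = l' - l := by rw [hadd']; push_cast; ring
      rw [hq, hlf, hlf']
      push_cast
      rw [show (m : ℚ) + 1 - (j + 1) = m - j by ring, show (m : ℚ) + 1 - j = m - j + 1 by ring]

lemma Module.length_quotient_le_of_le {S : Type*} [CommRing S] {J K : Ideal S} (h : J ≤ K) :
    Module.length S (S ⧸ K) ≤ Module.length S (S ⧸ J) :=
  Module.length_le_of_surjective (Submodule.factor h) (Submodule.factor_surjective h)

lemma Ideal.eq_of_length_quotient_eq {S : Type*} [CommRing S] {J K : Ideal S} (hle : J ≤ K)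
    {l : ℕ} (hJ : Module.length S (S ⧸ J) = l) (hK : Module.length S (S ⧸ K) = l) : J = K := by
  by_contra hne
  rw [Module.length_quotient] at hJ hK
  refine (Order.coheight_strictAnti (lt_of_le_of_ne hle hne) ?_).ne (hK.trans hJ.symm)
  rw [hK]
  exact ENat.natCast_lt_top l

/-- If the colengths of `I + 𝔪 ^ m` are eventually constant, their value is the colength of `I`. -/
lemma length_quotient_eq_of_forall_ge {S : Type*} [CommRing S] [IsNoetherianRing S]
    [IsLocalRing S] (I : Ideal S) (e N : ℕ)
    (h : ∀ m ≥ N, Module.length S (S ⧸ I ⊔ maximalIdeal S ^ m) = e) :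
    Module.length S (S ⧸ I) = e := by
  have heq : I ⊔ maximalIdeal S ^ (N + 1) = I ⊔ maximalIdeal S ^ N :=
    Ideal.eq_of_length_quotient_eq (sup_le_sup_left (Ideal.pow_le_pow_right N.le_succ) _)
      (h _ N.le_succ) (h N le_rfl)
  have hle : maximalIdeal S ^ N ≤ I := by
    refine Submodule.le_of_le_smul_of_le_jacobson_bot
      (IsNoetherian.noetherian (maximalIdeal S ^ N)) (maximalIdeal_le_jacobson _) ?_
    rw [smul_eq_mul, ← pow_succ', heq]
    exact le_sup_right
  have hN := h N le_rfl
  rwa [sup_eq_left.mpr hle] at hN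

lemma add_one_le_length_quotient {S : Type*} [CommRing S] [IsLocalRing S] (I : Ideal S)
    (hI : I ≤ maximalIdeal S) {e r : ℕ} (he : Module.length S (S ⧸ I) = e) (he1 : 1 < e)
    (hr : Module.length S (ResidueField S →ₗ[S] S ⧸ I) = r) :
    r + 1 ≤ e ∧ (r + 1 = e ↔ Module.length S (S ⧸ I ⊔ maximalIdeal S ^ 2) = e) := by
  let J : Ideal S := Submodule.colon I (maximalIdeal S : Set S)
  have hJ (b : S) : b ∈ J ↔ ∀ a ∈ maximalIdeal S, a * b ∈ I := by
    refine Submodule.mem_colon.trans (forall₂_congr fun a _ => ?_)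
    rw [smul_eq_mul, mul_comm]
  have hadd := length_hom_residueField_quotient I J hJ
  have hJm : J ≤ maximalIdeal S := by
    refine le_maximalIdeal fun htop => ?_
    have hle : maximalIdeal S ≤ I := fun a ha => by
      simpa using (hJ 1).mp (htop ▸ Submodule.mem_top) a ha
    rw [le_antisymm hI hle, length_quotient_maximalIdeal] at he
    have : e = 1 := by exact_mod_cast he.symm
    omega
  have h1 : 1 ≤ Module.length S (S ⧸ J) :=
    (length_quotient_maximalIdeal S).symm.trans_le (Module.length_quotient_le_of_le hJm)
  rw [he, hr] at hadd
  obtain ⟨l, hl⟩ := ENat.ne_top_iff_exists.mp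
    (ne_top_of_le_ne_top (ENat.natCast_ne_top e) (hadd ▸ le_add_self))
  rw [← hl] at hadd h1
  have hadd' : e = r + l := by exact_mod_cast hadd
  have h1' : 1 ≤ l := by exact_mod_cast h1
  refine ⟨by omega, fun h => ?_, fun h => ?_⟩
  · have hl1 : l = 1 := by omega
    rw [hl1] at hl
    have hJeq : J = maximalIdeal S := Ideal.eq_of_length_quotient_eq (l := 1) hJm hl.symm
      (by simpa using length_quotient_maximalIdeal S)
    have hle : maximalIdeal S ^ 2 ≤ I := by
      rw [pow_two, Ideal.mul_le]
      exact fun a ha b hb => (hJ b).mp (hJeq ▸ hb) a ha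
    rw [sup_eq_left.mpr hle, he]
  · have heq := Ideal.eq_of_length_quotient_eq le_sup_left he h
    have hle : maximalIdeal S ≤ J := fun b hb => (hJ b).mpr fun a ha => by
      rw [heq, pow_two]
      exact Ideal.mem_sup_right (Ideal.mul_mem_mul ha hb)
    rw [le_antisymm hJm hle, length_quotient_maximalIdeal] at hl
    have : l = 1 := by exact_mod_cast hl
    omega

lemma length_quotient_maximalIdeal_sq (R : Type*) [CommRing R] [IsNoetherianRing R]
    [IsLocalRing R] :
    Module.length R (R ⧸ maximalIdeal R ^ 2) =
      (Module.finrank (ResidueField R) (CotangentSpace R) + 1 : ℕ) := by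
  rw [Module.length_eq_add_of_exact (maximalIdeal R).cotangentToQuotientSquare
    (Submodule.factor (Ideal.pow_le_self two_ne_zero))
    (maximalIdeal R).cotangentToQuotientSquare_injective (Submodule.factor_surjective _),
    length_quotient_maximalIdeal]
  · have : Module.length R (CotangentSpace R) =
        Module.finrank (ResidueField R) (CotangentSpace R) := by
      rw [Module.length_eq_of_surjective (R := ResidueField R) residue_surjective,
        Module.length_eq_finrank]
    rw [Nat.cast_add, ← this, Nat.cast_one]
  · intro z
    obtain ⟨b, rfl⟩ := Submodule.mkQ_surjective _ z
    constructor
    · intro hb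
      have hb' : b ∈ maximalIdeal R := (Submodule.Quotient.mk_eq_zero _).mp hb
      exact ⟨(maximalIdeal R).toCotangent ⟨b, hb'⟩, rfl⟩
    · rintro ⟨w, hw⟩
      obtain ⟨w, rfl⟩ := (maximalIdeal R).toCotangent_surjective w
      rw [← hw]
      exact (Submodule.Quotient.mk_eq_zero _).mpr w.2

/-- Under a flat local extension with extended maximal ideal, the length of the socle modulo a
maximal regular sequence is preserved, and does not depend on the sequence. -/
lemma length_hom_residueField_eq_of_flat {R S : Type u} [CommRing R] [IsNoetherianRing R]
    [IsLocalRing R] [CommRing S] [IsNoetherianRing S] [IsLocalRing S] [Algebra R S]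
    [Module.Flat R S] (h : (maximalIdeal R).map (algebraMap R S) = maximalIdeal S)
    {rs : List R} (hrs : ∀ y ∈ rs, y ∈ maximalIdeal R)
    (hreg : RingTheory.Sequence.IsRegular S (rs.map (algebraMap R S)))
    {xs : List S} (hxs : ∀ y ∈ xs, y ∈ maximalIdeal S)
    (hreg' : RingTheory.Sequence.IsRegular S xs) (hlen : xs.length = rs.length) :
    Module.length S (ResidueField S →ₗ[S] S ⧸ Ideal.ofList xs) =
      Module.length R (ResidueField R →ₗ[R] R ⧸ Ideal.ofList rs) := by
  obtain ⟨e⟩ := nonempty_ext_linearEquiv_hom_quotient hxs hreg' hlen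
  obtain ⟨e'⟩ := nonempty_ext_linearEquiv_hom_quotient (d := rs.length) (fun y hy => by
    obtain ⟨z, hz, rfl⟩ := List.mem_map.mp hy
    exact h ▸ Ideal.mem_map_of_mem _ (hrs z hz)) hreg (by simp)
  let f : (S ⧸ (Ideal.ofList rs).map (algebraMap R S)) ≃ₗ[S]
      TensorProduct R S (R ⧸ Ideal.ofList rs) :=
    (Algebra.TensorProduct.quotIdealMapEquivTensorQuot S (Ideal.ofList rs)).toLinearEquiv
  have hf : Module.length S
      (ResidueField S →ₗ[S] S ⧸ (Ideal.ofList rs).map (algebraMap R S)) =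
      Module.length S (ResidueField S →ₗ[S] TensorProduct R S (R ⧸ Ideal.ofList rs)) :=
    (LinearEquiv.congrRight f).length_eq
  rw [← e.length_eq, e'.length_eq, ← Ideal.map_ofList, hf, length_hom_residueField_baseChange h]

/-- Let `(R, 𝔪)` be a Cohen–Macaulay local ring (Noetherian local of
dimension `d` admitting a regular sequence of length `d` inside `𝔪`) with Hilbert–Samuel
multiplicity `e(R) > 1` (the multiplicity is `d!` times the leading coefficient of the
Hilbert–Samuel polynomial `p`, where `ℓ_R(R/𝔪ⁿ) = p(n)` for `n ≫ 0`, lengths being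
witnessed by composition series), and Cohen–Macaulay type
`r(R) = dim_{R/𝔪} Ext^d_R(R/𝔪, R)`. Then `r(R) + 1 ≤ e(R)`, and equality holds if and
only if `R` has minimal multiplicity, i.e. `e(R) = v(R) - d + 1` where `v(R)` is the
embedding dimension. -/
theorem type_add_one_le_multiplicity
    (R : Type u) [CommRing R] [IsNoetherianRing R] [IsLocalRing R]
    (d : ℕ) (hdim : ringKrullDim R = d)
    (hCM : ∃ rs : List R, rs.length = d ∧ (∀ x ∈ rs, x ∈ maximalIdeal R) ∧
      RingTheory.Sequence.IsRegular R rs)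
    (p : Polynomial ℚ) (hpdeg : p.natDegree = d)
    (hHilb : ∃ N : ℕ, ∀ n ≥ N,
      ∃ s : CompositionSeries (Submodule R (R ⧸ (maximalIdeal R ^ n))),
        s.head = ⊥ ∧ s.last = ⊤ ∧ (s.length : ℚ) = p.eval (n : ℚ))
    (e : ℕ) (he : (e : ℚ) = (d.factorial : ℚ) * p.leadingCoeff)
    (r : ℕ) (hr : Nonempty ((((Ext R (ModuleCat.{u} R) d).obj
        (Opposite.op (ModuleCat.of R (ResidueField R)))).obj (ModuleCat.of R R))
      ≃ₗ[R] (Fin r → ResidueField R)))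
    (he1 : 1 < e) :
    r + 1 ≤ e ∧
      (r + 1 = e ↔
        (e : ℤ) = (Module.finrank (ResidueField R) (CotangentSpace R) : ℤ) - d + 1) := by
  obtain ⟨rs, hlen, hrs, hreg⟩ := hCM
  obtain ⟨N, hN⟩ := hHilb
  obtain ⟨hr⟩ := hr
  obtain ⟨hAB⟩ := ProjectiveResolution.nonempty_ext_linearEquiv
    (ModuleCat.of R (ResidueField R)) (ModuleCat.of R R) d
  obtain ⟨hhom⟩ := nonempty_ext_linearEquiv_hom_quotient hrs hreg hlen
  have hrlen : Module.length R (ResidueField R →ₗ[R] R ⧸ Ideal.ofList rs) = r := by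
    rw [((hhom.symm.trans hAB.symm).trans hr).length_eq, Module.length_pi,
      show Module.length R (ResidueField R) = 1 from length_quotient_maximalIdeal R]
    simp
  obtain ⟨S, _, _, _, _, _, hmap, _⟩ := exists_flat_infinite_residueField R
  have : IsLocalHom (algebraMap R S) := ((local_hom_TFAE _).out 0 2).mpr hmap.le
  have : Module.FaithfullyFlat R S := Module.FaithfullyFlat.of_flat_of_isLocalHom
  have hregS : RingTheory.Sequence.IsRegular S (rs.map (algebraMap R S)) := hreg.of_faithfullyFlat
  have hrsS : ∀ y ∈ rs.map (algebraMap R S), y ∈ maximalIdeal S := fun y hy => by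
    obtain ⟨z, hz, rfl⟩ := List.mem_map.mp hy
    exact hmap ▸ Ideal.mem_map_of_mem _ (hrs z hz)
  have hpow (m : ℕ) : Module.length S (S ⧸ maximalIdeal S ^ m) =
      Module.length R (R ⧸ maximalIdeal R ^ m) := by
    rw [← hmap, ← Ideal.map_pow, length_quotient_map hmap]
  obtain ⟨xs, hxlen, hxs, hxreg, hx2, N', hN'⟩ := exists_superficial_sequence hrsS hregS
    (fun x => p.eval x) N (fun m hm => by
      obtain ⟨s, hbot, htop, hs⟩ := hN m hm
      exact ⟨s.length, by rw [hpow, Module.length_compositionSeries s hbot htop], hs⟩) d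
    (by simp [hlen])
  have hI : Ideal.ofList xs ≤ maximalIdeal S := Ideal.span_le.mpr hxs
  have heS : Module.length S (S ⧸ Ideal.ofList xs) = e := by
    refine length_quotient_eq_of_forall_ge _ e N' fun m hm => ?_
    obtain ⟨l, hl, hle⟩ := hN' m hm
    have hdiff := congrFun p.fwdDiff_iter_degree_eq_factorial ((m : ℚ) - d)
    rw [hpdeg] at hdiff
    rw [hdiff, Pi.smul_apply, smul_eq_mul, Pi.natCast_apply, mul_comm, ← he] at hle
    rw [hl, Nat.cast_injective hle]
  have hrS : Module.length S (ResidueField S →ₗ[S] S ⧸ Ideal.ofList xs) = r := by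
    rw [length_hom_residueField_eq_of_flat hmap hrs hregS hxs hxreg (hxlen.trans hlen.symm), hrlen]
  rw [hpow, length_quotient_maximalIdeal_sq] at hx2
  obtain ⟨hle, hiff⟩ := add_one_le_length_quotient _ hI heS he1 hrS
  refine ⟨hle, hiff.trans ?_⟩
  obtain ⟨l, hl⟩ := ENat.ne_top_iff_exists.mp
    (ne_top_of_le_ne_top (ENat.natCast_ne_top _) (hx2 ▸ le_self_add))
  rw [← hl] at hx2 ⊢
  have hx2' : l + d = Module.finrank (ResidueField R) (CotangentSpace R) + 1 := by
    exact_mod_cast hx2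
  rw [Nat.cast_inj]
  omega
end

section
/- Let (R, m) be a one-dimensional Cohen-Macaulay local ring that is not a discrete valuation ring. Then R : m = m : m, and R is properly contained in m : m; in fact, the length of (m:m)/R as an R-module equals the Cohen-Macaulay type r(R). -/
set_option synthInstance.maxHeartbeats 400000

open IsLocalRing CategoryTheory

universe u

section LocalRing

variable {R : Type*} [CommRing R]

theorem mem_one_div_map_iff {K : Type*} [CommRing K] [Algebra R K] (I : Ideal R) (α : K) :
    α ∈ (1 : Submodule R K) / Submodule.map (Algebra.linearMap R K) I ↔
      ∀ a ∈ I, ∃ b : R, algebraMap R K b = α * algebraMap R K a := by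
  simp [Submodule.mem_div_iff_forall_mul_mem, Submodule.mem_one]

/-- If the maximal ideal is not principal, every element of `R : 𝔪` multiplies `𝔪` into `𝔪`. -/
theorem one_div_maximalIdeal_eq [IsLocalRing R]
    {K : Type*} [CommRing K] [Algebra R K] [FaithfulSMul R K]
    (h : ¬ (maximalIdeal R).IsPrincipal) :
    (1 : Submodule R K) / Submodule.map (Algebra.linearMap R K) (maximalIdeal R) =
      Submodule.map (Algebra.linearMap R K) (maximalIdeal R) /
        Submodule.map (Algebra.linearMap R K) (maximalIdeal R) := by
  have hinj := FaithfulSMul.algebraMap_injective R K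
  refine le_antisymm (fun α hα ↦ ?_) fun α hα ↦ ?_
  · rw [mem_one_div_map_iff] at hα
    rw [Submodule.mem_div_iff_forall_mul_mem]
    rintro _ ⟨a, ha, rfl⟩
    obtain ⟨b, hb⟩ := hα a ha
    refine ⟨b, ?_, hb⟩
    by_contra hbm
    have hbu : IsUnit b := by simpa using hbm
    obtain ⟨c, hc⟩ := hbu.exists_left_inv
    refine h ⟨a, le_antisymm (fun y hy ↦ ?_) ?_⟩
    · obtain ⟨d, hd⟩ := hα y hy
      refine Submodule.mem_span_singleton.mpr ⟨c * d, hinj ?_⟩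
      have hc' := congrArg (algebraMap R K) hc
      simp only [smul_eq_mul, map_mul, map_one] at hc' ⊢
      rw [hb] at hc'
      rw [hd]
      linear_combination algebraMap R K y * hc'
    · exact (Submodule.span_singleton_le_iff_mem _ _).mpr ha
  · rw [mem_one_div_map_iff]
    intro a ha
    obtain ⟨b, -, hb⟩ := Submodule.mem_div_iff_forall_mul_mem.mp hα _ ⟨a, ha, rfl⟩
    exact ⟨b, hb⟩

theorem exists_notMem_span_singleton_forall_mul_mem [IsNoetherianRing R] [IsLocalRing R]
    (hdim : ringKrullDim R ≤ 1) {x : R} (hx : x ∈ maximalIdeal R) (hx' : x ∈ nonZeroDivisors R) :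
    ∃ y ∉ Ideal.span {x}, ∀ a ∈ maximalIdeal R, a * y ∈ Ideal.span {x} := by
  classical
  have hrad : maximalIdeal R ≤ (Ideal.span {x}).radical := by
    rw [Ideal.radical_eq_sInf]
    refine le_sInf fun P ⟨hxP, hP⟩ ↦ ?_
    have : Ring.KrullDimLE 1 R := Ring.krullDimLE_iff.mpr hdim
    rcases Ring.krullDimLE_one_iff.mp this P hP with h | h
    · exact absurd hx' (Set.disjoint_left.mp
        (Ideal.disjoint_nonZeroDivisors_of_mem_minimalPrimes h)
        (hxP (Ideal.mem_span_singleton_self x)))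
    · exact (eq_maximalIdeal h).ge
  have hpow := Ideal.exists_pow_le_of_le_radical_of_fg hrad (IsNoetherian.noetherian _)
  have hne : Nat.find hpow ≠ 0 := by
    intro h0
    have := Nat.find_spec hpow
    rw [h0, pow_zero, Ideal.one_eq_top] at this
    exact (maximalIdeal.isMaximal R).ne_top (top_le_iff.mp
      (this.trans ((Ideal.span_singleton_le_iff_mem _).mpr hx)))
  obtain ⟨n, hn⟩ := Nat.exists_eq_succ_of_ne_zero hne
  obtain ⟨y, hy, hyx⟩ := SetLike.not_le_iff_exists.mp
    (Nat.find_min hpow (m := n) (by omega))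
  refine ⟨y, hyx, fun a ha ↦ ?_⟩
  have := Nat.find_spec hpow
  rw [hn, pow_succ'] at this
  exact this (Ideal.mul_mem_mul ha hy)

theorem one_lt_one_div_maximalIdeal [IsNoetherianRing R] [IsLocalRing R]
    {K : Type*} [CommRing K] [Algebra R K] [IsFractionRing R K]
    (hdim : ringKrullDim R ≤ 1) {x : R} (hx : x ∈ maximalIdeal R) (hx' : x ∈ nonZeroDivisors R) :
    (1 : Submodule R K) < 1 / Submodule.map (Algebra.linearMap R K) (maximalIdeal R) := by
  have hinj := IsFractionRing.injective R K
  refine SetLike.lt_iff_le_and_exists.mpr ⟨fun α hα ↦ ?_, ?_⟩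
  · obtain ⟨r, rfl⟩ := Submodule.mem_one.mp hα
    exact (mem_one_div_map_iff _ _).mpr fun a _ ↦ ⟨r * a, map_mul _ _ _⟩
  · obtain ⟨y, hy, hmy⟩ := exists_notMem_span_singleton_forall_mul_mem hdim hx hx'
    have hspec := IsLocalization.mk'_spec K y ⟨x, hx'⟩
    refine ⟨IsLocalization.mk' K y ⟨x, hx'⟩, (mem_one_div_map_iff _ _).mpr fun a ha ↦ ?_, ?_⟩
    · obtain ⟨b, hb⟩ := Ideal.mem_span_singleton'.mp (hmy a ha)
      refine ⟨b, (IsLocalization.map_units K (⟨x, hx'⟩ : nonZeroDivisors R)).mul_right_cancel ?_⟩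
      rw [mul_right_comm, hspec, ← map_mul, ← map_mul, hb, mul_comm]
    · rintro h
      obtain ⟨r, hr⟩ := Submodule.mem_one.mp h
      refine hy (Ideal.mem_span_singleton'.mpr ⟨r, hinj ?_⟩)
      rw [map_mul, hr, hspec]

end LocalRing

section Presentation

variable {R : Type*} [CommRing R] {I : Ideal R} {x : R}
  {P₀ P₁ P₂ : Type*} [AddCommGroup P₀] [Module R P₀] [AddCommGroup P₁] [Module R P₁]
  [AddCommGroup P₂] [Module R P₂]
  {d₂ : P₂ →ₗ[R] P₁} {d₁ : P₁ →ₗ[R] P₀} {π : P₀ →ₗ[R] R ⧸ I}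

theorem exists_smul_eq_of_exact (h₀ : Function.Exact d₁ π) {a : R} (ha : a ∈ I) (p : P₀) :
    ∃ q, d₁ q = a • p := by
  refine (h₀ (a • p)).mp ?_
  obtain ⟨s, hs⟩ := Ideal.Quotient.mk_surjective (π p)
  rw [map_smul, ← hs, ← Ideal.Quotient.mk_eq_mk, ← Submodule.Quotient.mk_smul,
    Submodule.Quotient.mk_eq_zero]
  exact I.mul_mem_right _ ha

theorem cocycle_eq_of_map_eq (h₁ : Function.Exact d₂ d₁) {f : P₁ →ₗ[R] R} (hf : f ∘ₗ d₂ = 0)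
    {q q' : P₁} (h : d₁ q = d₁ q') : f q = f q' := by
  obtain ⟨z, hz⟩ := (h₁ (q - q')).mp (by rw [map_sub, h, sub_self])
  rw [← sub_eq_zero, ← map_sub, ← hz]
  exact LinearMap.congr_fun hf z

theorem exists_mul_eq_cocycle_mul (h₀ : Function.Exact d₁ π) (h₁ : Function.Exact d₂ d₁)
    {p₀ : P₀} {q₀ : P₁} (hq₀ : d₁ q₀ = x • p₀) {f : P₁ →ₗ[R] R} (hf : f ∘ₗ d₂ = 0)
    {a : R} (ha : a ∈ I) : ∃ b, x * b = a * f q₀ := by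
  obtain ⟨q, hq⟩ := exists_smul_eq_of_exact h₀ ha p₀
  refine ⟨f q, ?_⟩
  rw [← smul_eq_mul, ← smul_eq_mul, ← map_smul, ← map_smul]
  exact cocycle_eq_of_map_eq h₁ hf (by rw [map_smul, map_smul, hq, hq₀, smul_comm])

/-- A cocycle is a coboundary as soon as its value at a lift of `x • p₀` is divisible by the
nonzerodivisor `x`, where `p₀` lifts the generator of `R ⧸ I`. -/
theorem cocycle_isCoboundary_iff (hx : x ∈ I) (hx' : x ∈ nonZeroDivisors R)
    (h₀ : Function.Exact d₁ π) (h₁ : Function.Exact d₂ d₁)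
    {p₀ : P₀} (hp₀ : π p₀ = 1) {q₀ : P₁} (hq₀ : d₁ q₀ = x • p₀)
    {f : P₁ →ₗ[R] R} (hf : f ∘ₗ d₂ = 0) :
    (∃ h : P₀ →ₗ[R] R, h ∘ₗ d₁ = f) ↔ ∃ r, x * r = f q₀ := by
  constructor
  · rintro ⟨h, rfl⟩
    exact ⟨h p₀, by simp [hq₀]⟩
  · rintro ⟨r, hr⟩
    have key (p : P₀) : ∃ s, ∀ q, d₁ q = x • p → f q = x * s := by
      obtain ⟨a, ha⟩ := Ideal.Quotient.mk_surjective (π p)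
      obtain ⟨q', hq'⟩ := (h₀ (p - a • p₀)).mp (by
        rw [map_sub, map_smul, hp₀, ← ha, ← map_one (Ideal.Quotient.mk I),
          ← Ideal.Quotient.mk_eq_mk, ← Ideal.Quotient.mk_eq_mk, ← Submodule.Quotient.mk_smul]
        simp)
      refine ⟨a * r + f q', fun q hq ↦ ?_⟩
      rw [cocycle_eq_of_map_eq h₁ hf (q' := a • q₀ + x • q')
        (by rw [hq, map_add, map_smul, map_smul, hq', hq₀, smul_sub, smul_comm x a]; abel)]
      rw [map_add, map_smul, map_smul, ← hr, smul_eq_mul, smul_eq_mul]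
      ring
    choose s hs using key
    have hex := exists_smul_eq_of_exact h₀ hx
    refine ⟨{ toFun := s, map_add' := fun p p' ↦ ?_, map_smul' := fun a p ↦ ?_ }, ?_⟩
    · obtain ⟨q, hq⟩ := hex p
      obtain ⟨q', hq'⟩ := hex p'
      refine (mul_cancel_left_mem_nonZeroDivisors hx').mp ?_
      rw [mul_add, ← hs _ q hq, ← hs _ q' hq', ← map_add, hs _ (q + q')]
      rw [map_add, hq, hq', smul_add]
    · obtain ⟨q, hq⟩ := hex p
      refine (mul_cancel_left_mem_nonZeroDivisors hx').mp ?_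
      rw [RingHom.id_apply, smul_eq_mul, mul_left_comm, ← hs _ q hq, ← smul_eq_mul a, ← map_smul,
        hs _ (a • q)]
      rw [map_smul, hq, smul_comm]
    · ext q
      refine (mul_cancel_left_mem_nonZeroDivisors hx').mp ?_
      change x * s (d₁ q) = x * f q
      rw [← hs (d₁ q) (x • q) (map_smul _ _ _), map_smul, smul_eq_mul]

theorem exists_cocycle_of_forall_mul_mem [Module.Projective R P₀]
    (hx' : x ∈ nonZeroDivisors R)
    (h₀ : Function.Exact d₁ π) (h₁ : Function.Exact d₂ d₁)
    {p₀ : P₀} (hp₀ : π p₀ = 1) {q₀ : P₁} (hq₀ : d₁ q₀ = x • p₀)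
    {b : R} (hb : ∀ a ∈ I, a * b ∈ Ideal.span {x}) :
    ∃ f : P₁ →ₗ[R] R, f ∘ₗ d₂ = 0 ∧ ∃ r, f q₀ = b + x * r := by
  let φ : (R ⧸ I) →ₗ[R] (R ⧸ Ideal.span {x}) :=
    Submodule.liftQ I ((Submodule.mkQ (Ideal.span {x})) ∘ₗ LinearMap.toSpanSingleton R R b)
      fun a ha ↦ by
        rw [LinearMap.mem_ker, LinearMap.comp_apply, Submodule.mkQ_apply,
          Submodule.Quotient.mk_eq_zero]
        exact hb a ha
  obtain ⟨h, hh⟩ := Module.projective_lifting_property (Submodule.mkQ (Ideal.span {x})) (φ ∘ₗ π)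
    (Submodule.mkQ_surjective _)
  have hdvd (q : P₁) : ∃ s, h (d₁ q) = x * s := by
    have : Submodule.mkQ (Ideal.span {x}) (h (d₁ q)) = 0 := by
      rw [← LinearMap.comp_apply, hh, LinearMap.comp_apply, h₀.apply_apply_eq_zero, map_zero]
    rw [Submodule.mkQ_apply, Submodule.Quotient.mk_eq_zero, Ideal.mem_span_singleton] at this
    exact this
  choose s hs using hdvd
  refine ⟨{ toFun := s, map_add' := fun q q' ↦ ?_, map_smul' := fun a q ↦ ?_ }, ?_, ?_⟩
  · refine (mul_cancel_left_mem_nonZeroDivisors hx').mp ?_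
    rw [mul_add, ← hs, ← hs, ← hs, map_add, map_add]
  · refine (mul_cancel_left_mem_nonZeroDivisors hx').mp ?_
    rw [RingHom.id_apply, smul_eq_mul, mul_left_comm, ← hs, ← hs, map_smul, map_smul, smul_eq_mul]
  · ext z
    refine (mul_cancel_left_mem_nonZeroDivisors hx').mp ?_
    change x * s (d₂ z) = x * 0
    rw [← hs, h₁.apply_apply_eq_zero, map_zero, mul_zero]
  · have hsq : s q₀ = h p₀ := (mul_cancel_left_mem_nonZeroDivisors hx').mp (by
      rw [← hs, hq₀, map_smul, smul_eq_mul])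
    have : Submodule.mkQ (Ideal.span {x}) (h p₀) = Submodule.mkQ (Ideal.span {x}) b := by
      rw [← LinearMap.comp_apply, hh, LinearMap.comp_apply, hp₀]
      change Submodule.mkQ (Ideal.span {x}) ((1 : R) • b) = _
      rw [one_smul]
    rw [← sub_eq_zero, ← map_sub, Submodule.mkQ_apply, Submodule.Quotient.mk_eq_zero,
      Ideal.mem_span_singleton] at this
    obtain ⟨r, hr⟩ := this
    exact ⟨r, by change s q₀ = _; rw [hsq, ← hr]; ring⟩

/-- Cocycles modulo coboundaries of `Hom(P, R)` in degree one, where `P` is the beginning of a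
projective resolution of `R ⧸ I`, are identified with `(R : I) / R`. -/
theorem exists_surjective_cocycles_to_colon [Module.Projective R P₀]
    {K : Type*} [CommRing K] [Algebra R K] [IsFractionRing R K]
    (hx : x ∈ I) (hx' : x ∈ nonZeroDivisors R) (hπ : Function.Surjective π)
    (h₀ : Function.Exact d₁ π) (h₁ : Function.Exact d₂ d₁)
    {Z : Type*} [AddCommGroup Z] [Module R Z] (ι : Z →ₗ[R] (P₁ →ₗ[R] R))
    (hι : ∀ f, f ∈ LinearMap.range ι ↔ f ∘ₗ d₂ = 0)
    (D : Submodule R K) (hD : D = 1 / Submodule.map (Algebra.linearMap R K) I) :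
    ∃ e : Z →ₗ[R] (D ⧸ (1 : Submodule R K).comap D.subtype), Function.Surjective e ∧
      ∀ z, e z = 0 ↔ ∃ h : P₀ →ₗ[R] R, h ∘ₗ d₁ = ι z := by
  subst hD
  obtain ⟨p₀, hp₀⟩ := hπ 1
  obtain ⟨q₀, hq₀⟩ := exists_smul_eq_of_exact h₀ hx p₀
  have hinj := IsFractionRing.injective R K
  have hux : algebraMap R K x * IsLocalization.mk' K 1 (⟨x, hx'⟩ : nonZeroDivisors R) = 1 := by
    rw [mul_comm, IsLocalization.mk'_spec K 1 (⟨x, hx'⟩ : nonZeroDivisors R), map_one]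
  generalize IsLocalization.mk' K 1 (⟨x, hx'⟩ : nonZeroDivisors R) = u at hux
  have hcoc (z : Z) : ι z ∘ₗ d₂ = 0 := (hι _).mp ⟨z, rfl⟩
  let ev : Z →ₗ[R] K :=
    (LinearMap.mulLeft R u) ∘ₗ Algebra.linearMap R K ∘ₗ LinearMap.applyₗ q₀ ∘ₗ ι
  have hev (z : Z) : ev z = u * algebraMap R K (ι z q₀) := rfl
  let ev' := ev.codRestrict (1 / Submodule.map (Algebra.linearMap R K) I) fun z ↦ by
    rw [mem_one_div_map_iff]
    intro a ha
    obtain ⟨b, hb⟩ := exists_mul_eq_cocycle_mul h₀ h₁ hq₀ (hcoc z) ha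
    have hb' := congrArg (algebraMap R K) hb
    rw [map_mul, map_mul] at hb'
    refine ⟨b, ?_⟩
    rw [hev]
    linear_combination u * hb' - algebraMap R K b * hux
  refine ⟨Submodule.mkQ _ ∘ₗ ev', ?_, fun z ↦ ?_⟩
  · intro t
    obtain ⟨⟨α, hα⟩, rfl⟩ := Submodule.mkQ_surjective _ t
    have hα' := (mem_one_div_map_iff _ _).mp hα
    obtain ⟨b, hb⟩ := hα' x hx
    obtain ⟨f, hf, r, hr⟩ := exists_cocycle_of_forall_mul_mem hx' h₀ h₁ hp₀ hq₀ (b := b)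
      fun a ha ↦ by
        obtain ⟨c, hc⟩ := hα' a ha
        refine Ideal.mem_span_singleton'.mpr ⟨c, hinj ?_⟩
        rw [map_mul, map_mul, hc, hb]
        ring
    obtain ⟨z, rfl⟩ := (hι f).mpr hf
    refine ⟨z, ?_⟩
    rw [LinearMap.comp_apply, ← sub_eq_zero, ← map_sub, Submodule.mkQ_apply,
      Submodule.Quotient.mk_eq_zero]
    refine Submodule.mem_one.mpr ⟨r, ?_⟩
    change _ = ev z - α
    rw [hev, hr, map_add, map_mul, hb]
    linear_combination (-algebraMap R K r - α) * hux
  · rw [cocycle_isCoboundary_iff hx hx' h₀ h₁ hp₀ hq₀ (hcoc z), LinearMap.comp_apply,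
      Submodule.mkQ_apply, Submodule.Quotient.mk_eq_zero]
    change ev z ∈ (1 : Submodule R K) ↔ _
    rw [Submodule.mem_one, hev]
    refine exists_congr fun r ↦ ⟨fun h ↦ hinj ?_, fun h ↦ ?_⟩
    · rw [map_mul, h]
      linear_combination algebraMap R K (ι z q₀) * hux
    · rw [← h, map_mul]
      linear_combination -algebraMap R K r * hux

end Presentation

theorem exists_compositionSeries_of_length_eq {R M : Type*} [Ring R] [AddCommGroup M] [Module R M]
    {n : ℕ} (h : Module.length R M = n) :
    ∃ s : CompositionSeries (Submodule R M), s.head = ⊥ ∧ s.last = ⊤ ∧ s.length = n := by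
  obtain ⟨s, h₁, h₂⟩ := isFiniteLength_iff_exists_compositionSeries.mp
    (Module.length_ne_top_iff.mp (h ▸ ENat.natCast_ne_top n))
  exact ⟨s, h₁, h₂, by exact_mod_cast (Module.length_compositionSeries s h₁ h₂).trans h⟩

theorem length_fin_fun_residueField (R : Type*) [CommRing R] [IsLocalRing R] (n : ℕ) :
    Module.length R (Fin n → ResidueField R) = n := by
  have : IsSimpleModule R (ResidueField R) :=
    (isSimpleModule_iff_isCoatom.mpr (maximalIdeal.isMaximal R).out :
      IsSimpleModule R (R ⧸ maximalIdeal R))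
  simp [Module.length_pi_of_fintype, Module.length_eq_one]

/-- `Ext¹(R ⧸ I, R) ≅ (R : I) / R` for an ideal `I` containing a nonzerodivisor. -/
theorem nonempty_ext_one_equiv_colon_quotient {R : Type u} [CommRing R] {I : Ideal R} {x : R}
    (hx : x ∈ I) (hx' : x ∈ nonZeroDivisors R)
    {K : Type*} [CommRing K] [Algebra R K] [IsFractionRing R K]
    (D : Submodule R K) (hD : D = 1 / Submodule.map (Algebra.linearMap R K) I) :
    Nonempty ((((Ext R (ModuleCat.{u} R) 1).obj
        (Opposite.op (ModuleCat.of R (R ⧸ I)))).obj (ModuleCat.of R R)) ≃ₗ[R]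
      (D ⧸ (1 : Submodule R K).comap D.subtype)) := by
  let P := projectiveResolution (ModuleCat.of R (R ⧸ I))
  let S := (P.complex.linearYonedaObj R (ModuleCat.of R R)).sc' 0 1 2
  have iso : ((Ext R (ModuleCat.{u} R) 1).obj
      (Opposite.op (ModuleCat.of R (R ⧸ I)))).obj (ModuleCat.of R R) ≅
        ModuleCat.of R (LinearMap.ker S.g.hom ⧸ LinearMap.range S.moduleCatToCycles) :=
    P.isoExt 1 _ ≪≫ HomologicalComplex.homologyIsoSc' _ 0 1 2 (by simp) (by simp) ≪≫
      S.moduleCatHomologyIso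
  let d₁ : P.complex.X 1 →ₗ[R] P.complex.X 0 := (P.complex.d 1 0).hom
  let d₂ : P.complex.X 2 →ₗ[R] P.complex.X 1 := (P.complex.d 2 1).hom
  let π : P.complex.X 0 →ₗ[R] R ⧸ I := (P.π.f 0).hom
  have hπ : Function.Surjective π := (ModuleCat.epi_iff_surjective _).mp inferInstance
  have h₁ : Function.Exact d₂ d₁ :=
    (ShortComplex.ShortExact.moduleCat_exact_iff_function_exact _).mp (P.exact_succ 0)
  have h₀ : Function.Exact d₁ π :=
    (ShortComplex.ShortExact.moduleCat_exact_iff_function_exact _).mp P.exact₀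
  let ι : LinearMap.ker S.g.hom →ₗ[R] (P.complex.X 1 →ₗ[R] R) :=
    (ModuleCat.homLinearEquiv (S := R) (M := P.complex.X 1)
      (N := ModuleCat.of R R)).toLinearMap ∘ₗ (LinearMap.ker S.g.hom).subtype
  obtain ⟨e, he, hker⟩ := exists_surjective_cocycles_to_colon hx hx' hπ h₀ h₁ ι (fun f ↦ by
    constructor
    · rintro ⟨⟨z, hz⟩, rfl⟩
      exact congrArg ModuleCat.Hom.hom hz
    · intro hf
      exact ⟨⟨ModuleCat.ofHom f, ModuleCat.hom_ext hf⟩, rfl⟩) D hD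
  have hrange : LinearMap.range S.moduleCatToCycles = LinearMap.ker e := by
    ext z
    rw [LinearMap.mem_ker, hker]
    constructor
    · rintro ⟨h, rfl⟩
      exact ⟨ModuleCat.Hom.hom h, rfl⟩
    · rintro ⟨h, hh⟩
      exact ⟨ModuleCat.ofHom h, Subtype.ext (ModuleCat.hom_ext hh)⟩
  exact ⟨iso.toLinearEquiv ≪≫ₗ Submodule.quotEquivOfEq _ _ hrange ≪≫ₗ
    e.quotKerEquivOfSurjective he⟩

/-- Let `(R, 𝔪)` be a one-dimensional Cohen–Macaulay local ring which
is not a discrete valuation ring (i.e. `𝔪` is not principal). Then, inside `Q(R)`,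
`R : 𝔪 = 𝔪 : 𝔪`, `R` is properly contained in `𝔪 : 𝔪`, and the length of
`(𝔪 : 𝔪)/R` as an `R`-module equals the Cohen–Macaulay type
`r(R) = dim_{R/𝔪} Ext¹_R(R/𝔪, R)`. -/
theorem colon_maximalIdeal_eq_endomorphism
    (R : Type u) [CommRing R] [IsNoetherianRing R] [IsLocalRing R]
    (hdim : ringKrullDim R = 1)
    (hCM : ∃ x ∈ maximalIdeal R, x ∈ nonZeroDivisors R)
    (hnotDVR : ¬ (maximalIdeal R).IsPrincipal)
    (r : ℕ) (hr : Nonempty ((((Ext R (ModuleCat.{u} R) 1).obj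
        (Opposite.op (ModuleCat.of R (ResidueField R)))).obj (ModuleCat.of R R))
      ≃ₗ[R] (Fin r → ResidueField R))) :
    (1 : Submodule R (FractionRing R)) /
        Submodule.map (Algebra.linearMap R (FractionRing R)) (maximalIdeal R) =
      Submodule.map (Algebra.linearMap R (FractionRing R)) (maximalIdeal R) /
        Submodule.map (Algebra.linearMap R (FractionRing R)) (maximalIdeal R) ∧
    (1 : Submodule R (FractionRing R)) <
      Submodule.map (Algebra.linearMap R (FractionRing R)) (maximalIdeal R) /
        Submodule.map (Algebra.linearMap R (FractionRing R)) (maximalIdeal R) ∧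
    ∃ s : CompositionSeries (Submodule R
        ((Submodule.map (Algebra.linearMap R (FractionRing R)) (maximalIdeal R) /
            Submodule.map (Algebra.linearMap R (FractionRing R)) (maximalIdeal R) :
            Submodule R (FractionRing R)) ⧸
          Submodule.comap
            (Submodule.map (Algebra.linearMap R (FractionRing R)) (maximalIdeal R) /
              Submodule.map (Algebra.linearMap R (FractionRing R))
                (maximalIdeal R)).subtype
            (1 : Submodule R (FractionRing R)))),
      s.head = ⊥ ∧ s.last = ⊤ ∧ s.length = r := by
  obtain ⟨x, hx, hx'⟩ := hCM
  have heq := one_div_maximalIdeal_eq (K := FractionRing R) hnotDVR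
  refine ⟨heq, heq ▸ one_lt_one_div_maximalIdeal hdim.le hx hx', ?_⟩
  obtain ⟨e⟩ := hr
  obtain ⟨e'⟩ := nonempty_ext_one_equiv_colon_quotient hx hx' _ heq.symm
  exact exists_compositionSeries_of_length_eq
    ((e'.symm.trans e).length_eq.trans (length_fin_fun_residueField R r))
end
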